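/- arXiv:1706.01873 — 2 statements merged into one kernel-verified Lean document; each statement's English description precedes it below -/
import Mathlib

section
/- Let u be a solution of the K_{ψ,f}(Ω)-obstacle problem and let x ∈ Ω satisfy ψ^∨(x) = esslimsup_{y→x} ψ(y) (as a value in [−∞,∞], where esslimsup_{y→x} ψ(y) := lim_{r→0} esssup_{B(x,r)} ψ). Then u^∨ is upper semicontinuous at x as a [−∞,∞]-valued function; moreover, if ψ^∨(x) < ∞, then u^∨ is real-valued in a neighborhood of x and upper semicontinuous at x as a real-valued function. -/
open MeasureTheory Metric Filter Set
open scoped ENNReal NNReal Topology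

noncomputable section

namespace MetricBV

variable {X : Type*} [MetricSpace X] [MeasurableSpace X]

/-- A rectifiable curve, encoded as a Lipschitz map on the interval `[0,1]`
(every rectifiable curve admits such a reparametrization). -/
structure Curve (X : Type*) [MetricSpace X] where
  toFun : ℝ → X
  lipschitz : ∃ K : ℝ≥0, LipschitzOnWith K toFun (Set.Icc 0 1)

/-- The metric speed of a curve at a point. -/
def speed (γ : ℝ → X) (t : ℝ) : ℝ≥0∞ :=
  Filter.limsup (fun h : ℝ => ENNReal.ofReal (dist (γ (t + h)) (γ t) / |h|)) (𝓝[≠] (0 : ℝ))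

/-- The curve integral `∫_γ g ds`. -/
def curveIntegral (g : X → ℝ≥0∞) (γ : Curve X) : ℝ≥0∞ :=
  ∫⁻ t in Set.Icc (0 : ℝ) 1, g (γ.toFun t) * speed γ.toFun t

/-- A curve lies in a set `Ω`. -/
def Curve.In (γ : Curve X) (Ω : Set X) : Prop :=
  ∀ t ∈ Set.Icc (0 : ℝ) 1, γ.toFun t ∈ Ω

/-- The 1-modulus of a family of curves. -/
def Mod1 (μ : Measure X) (Γ : Set (Curve X)) : ℝ≥0∞ :=
  ⨅ (ρ : X → ℝ≥0∞) (_ : Measurable ρ) (_ : ∀ γ ∈ Γ, 1 ≤ curveIntegral ρ γ),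
    ∫⁻ x, ρ x ∂μ

/-- `g` is an upper gradient of `u` in `Ω`: the upper gradient inequality holds
along every curve contained in `Ω`. -/
def IsUpperGradientOn (g : X → ℝ≥0∞) (u : X → ℝ) (Ω : Set X) : Prop :=
  ∀ γ : Curve X, γ.In Ω →
    ENNReal.ofReal |u (γ.toFun 1) - u (γ.toFun 0)| ≤ curveIntegral g γ

/-- `g` is a 1-weak upper gradient of `u` in `Ω`: the upper gradient inequality holds
along every curve in `Ω` outside a family of zero 1-modulus. -/
def IsWeakUpperGradientOn (μ : Measure X) (g : X → ℝ≥0∞) (u : X → ℝ) (Ω : Set X) : Prop :=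
  ∃ Γ : Set (Curve X), Mod1 μ Γ = 0 ∧
    ∀ γ : Curve X, γ ∉ Γ → γ.In Ω →
      ENNReal.ofReal |u (γ.toFun 1) - u (γ.toFun 0)| ≤ curveIntegral g γ

/-- Membership in the Newtonian space `N^{1,1}(X)`. -/
def MemN11 (μ : Measure X) (u : X → ℝ) : Prop :=
  Integrable u μ ∧ ∃ g : X → ℝ≥0∞, Measurable g ∧
    IsWeakUpperGradientOn μ g u Set.univ ∧ ∫⁻ x, g x ∂μ < ⊤

/-- The 1-capacity `cap₁(A) = inf ‖u‖_{N^{1,1}(X)}` over `u ∈ N^{1,1}(X)` with `u ≥ 1` on `A`. -/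
def cap1 (μ : Measure X) (A : Set X) : ℝ≥0∞ :=
  ⨅ (u : X → ℝ) (_ : MemN11 μ u) (_ : ∀ x ∈ A, 1 ≤ u x)
    (g : X → ℝ≥0∞) (_ : Measurable g) (_ : IsWeakUpperGradientOn μ g u Set.univ),
    (∫⁻ x, ENNReal.ofReal |u x| ∂μ + ∫⁻ x, g x ∂μ)

/-- The variational 1-capacity `cap₁(A,Ω) = inf ∫ g_u dμ` over `u ∈ N^{1,1}(X)` with
`u ≥ 1` on `A` and `u = 0` on `X ∖ Ω`. -/
def vcap1 (μ : Measure X) (A Ω : Set X) : ℝ≥0∞ :=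
  ⨅ (u : X → ℝ) (_ : MemN11 μ u) (_ : ∀ x ∈ A, 1 ≤ u x) (_ : ∀ x ∈ Ωᶜ, u x = 0)
    (g : X → ℝ≥0∞) (_ : Measurable g) (_ : IsWeakUpperGradientOn μ g u Set.univ),
    ∫⁻ x, g x ∂μ

/-- Locally Lipschitz in `Ω`: Lipschitz on every compact subset of `Ω`. -/
def LocLipschitzOn (u : X → ℝ) (Ω : Set X) : Prop :=
  ∀ K : Set X, IsCompact K → K ⊆ Ω → ∃ L : ℝ≥0, LipschitzOnWith L u K

/-- Convergence `v i → u` in `L¹_loc(Ω)`. -/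
def TendstoL1Loc (μ : Measure X) (v : ℕ → X → ℝ) (u : X → ℝ) (Ω : Set X) : Prop :=
  ∀ K : Set X, IsCompact K → K ⊆ Ω →
    Filter.Tendsto (fun i => ∫⁻ x in K, ENNReal.ofReal |v i x - u x| ∂μ)
      Filter.atTop (𝓝 0)

/-- The total variation `‖Du‖(Ω)` of `u` in an open set `Ω`: the infimum of
`liminf ∫_Ω g_i dμ` over sequences of locally Lipschitz functions `v i → u` in `L¹_loc(Ω)`
with `g i` a 1-weak upper gradient of `v i` in `Ω`. -/
def tv (μ : Measure X) (u : X → ℝ) (Ω : Set X) : ℝ≥0∞ :=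
  ⨅ (v : ℕ → X → ℝ) (_ : ∀ i, LocLipschitzOn (v i) Ω) (_ : TendstoL1Loc μ v u Ω)
    (g : ℕ → X → ℝ≥0∞) (_ : ∀ i, Measurable (g i))
    (_ : ∀ i, IsWeakUpperGradientOn μ (g i) (v i) Ω),
    Filter.liminf (fun i => ∫⁻ x in Ω, g i x ∂μ) Filter.atTop

/-- The total variation `‖Du‖(A)` for an arbitrary set `A`. -/
def tvs (μ : Measure X) (u : X → ℝ) (A : Set X) : ℝ≥0∞ :=
  ⨅ (U : Set X) (_ : IsOpen U) (_ : A ⊆ U), tv μ u U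

/-- The characteristic function of a set, as a real-valued function. -/
def chi (E : Set X) : X → ℝ := Set.indicator E fun _ => (1 : ℝ)

/-- The perimeter `P(E,Ω) = ‖Dχ_E‖(Ω)` of `E` in an open set `Ω`. -/
def perim (μ : Measure X) (E : Set X) (Ω : Set X) : ℝ≥0∞ := tv μ (chi E) Ω

/-- `u ∈ BV(Ω)`: `u ∈ L¹(Ω)` and `‖Du‖(Ω) < ∞`. -/
def MemBV (μ : Measure X) (u : X → ℝ) (Ω : Set X) : Prop :=
  IntegrableOn u Ω μ ∧ tv μ u Ω < ⊤

/-- `u ∈ BV_loc(Ω)`. -/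
def MemBVloc (μ : Measure X) (u : X → ℝ) (Ω : Set X) : Prop :=
  ∀ K : Set X, IsCompact K → K ⊆ Ω → ∃ U : Set X, IsOpen U ∧ K ⊆ U ∧ U ⊆ Ω ∧ MemBV μ u U

/-- `φ ∈ BV_c(Ω)`: a BV function with compact support in `Ω`. -/
def MemBVc (μ : Measure X) (φ : X → ℝ) (Ω : Set X) : Prop :=
  MemBV μ φ Ω ∧ IsCompact (tsupport φ) ∧ tsupport φ ⊆ Ω

/-- `u` is a 1-minimizer (function of least gradient) in `Ω`. -/
def IsMinimizer (μ : Measure X) (u : X → ℝ) (Ω : Set X) : Prop :=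
  MemBVloc μ u Ω ∧ ∀ φ : X → ℝ, MemBVc μ φ Ω →
    tvs μ u (tsupport φ) ≤ tvs μ (fun y => u y + φ y) (tsupport φ)

/-- `u` is a 1-superminimizer in `Ω`. -/
def IsSuperminimizer (μ : Measure X) (u : X → ℝ) (Ω : Set X) : Prop :=
  MemBVloc μ u Ω ∧ ∀ φ : X → ℝ, MemBVc μ φ Ω → (∀ x, 0 ≤ φ x) →
    tvs μ u (tsupport φ) ≤ tvs μ (fun y => u y + φ y) (tsupport φ)

/-- `u` is a 1-subminimizer in `Ω`. -/
def IsSubminimizer (μ : Measure X) (u : X → ℝ) (Ω : Set X) : Prop :=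
  MemBVloc μ u Ω ∧ ∀ φ : X → ℝ, MemBVc μ φ Ω → (∀ x, φ x ≤ 0) →
    tvs μ u (tsupport φ) ≤ tvs μ (fun y => u y + φ y) (tsupport φ)

/-- The lower approximate limit `u^∧(x)`, with values in `[-∞,∞]`. -/
def lowerApprox (μ : Measure X) (u : X → ℝ) (x : X) : EReal :=
  sSup ((fun t : ℝ => (t : EReal)) '' {t : ℝ | Filter.Tendsto
    (fun r : ℝ => μ ({y | u y < t} ∩ Metric.ball x r) / μ (Metric.ball x r))
    (𝓝[>] (0 : ℝ)) (𝓝 0)})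

/-- The upper approximate limit `u^∨(x)`, with values in `[-∞,∞]`. -/
def upperApprox (μ : Measure X) (u : X → ℝ) (x : X) : EReal :=
  sInf ((fun t : ℝ => (t : EReal)) '' {t : ℝ | Filter.Tendsto
    (fun r : ℝ => μ ({y | t < u y} ∩ Metric.ball x r) / μ (Metric.ball x r))
    (𝓝[>] (0 : ℝ)) (𝓝 0)})

/-- The upper approximate limit of an extended-real-valued function. -/
def upperApproxE (μ : Measure X) (ψ : X → EReal) (x : X) : EReal :=
  sInf ((fun t : ℝ => (t : EReal)) '' {t : ℝ | Filter.Tendsto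
    (fun r : ℝ => μ ({y | (t : EReal) < ψ y} ∩ Metric.ball x r) / μ (Metric.ball x r))
    (𝓝[>] (0 : ℝ)) (𝓝 0)})

/-- The measure-theoretic interior `I_E`. -/
def measInterior (μ : Measure X) (E : Set X) : Set X :=
  {x : X | Filter.Tendsto (fun r : ℝ => μ (Metric.ball x r \ E) / μ (Metric.ball x r))
    (𝓝[>] (0 : ℝ)) (𝓝 0)}

/-- The measure-theoretic boundary `∂*E`. -/
def measBoundary (μ : Measure X) (E : Set X) : Set X :=
  {x : X | 0 < Filter.limsup (fun r : ℝ => μ (Metric.ball x r ∩ E) / μ (Metric.ball x r))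
      (𝓝[>] (0 : ℝ)) ∧
    0 < Filter.limsup (fun r : ℝ => μ (Metric.ball x r \ E) / μ (Metric.ball x r))
      (𝓝[>] (0 : ℝ))}

/-- `A` is 1-thin at `x`. -/
def IsThinAt (μ : Measure X) (A : Set X) (x : X) : Prop :=
  Filter.Tendsto (fun r : ℝ =>
      ENNReal.ofReal r * vcap1 μ (A ∩ Metric.ball x r) (Metric.ball x (2 * r))
        / μ (Metric.ball x r))
    (𝓝[>] (0 : ℝ)) (𝓝 0)

/-- `U` is 1-finely open. -/
def IsFinelyOpen (μ : Measure X) (U : Set X) : Prop :=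
  ∀ x ∈ U, IsThinAt μ Uᶜ x

/-- The class `K_{ψ,f}(Ω)` of admissible functions for the obstacle problem. -/
def MemK (μ : Measure X) (ψ : X → EReal) (f : X → ℝ) (Ω : Set X) (u : X → ℝ) : Prop :=
  MemBVloc μ u Set.univ ∧ (∀ᵐ x ∂μ, x ∈ Ω → ψ x ≤ (u x : EReal)) ∧
    (∀ᵐ x ∂μ, x ∉ Ω → u x = f x)

/-- `u` is a solution of the `K_{ψ,f}(Ω)`-obstacle problem. -/
def IsObstacleSolution (μ : Measure X) (ψ : X → EReal) (f : X → ℝ) (Ω : Set X)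
    (u : X → ℝ) : Prop :=
  MemK μ ψ f Ω u ∧ ∀ v : X → ℝ, MemK μ ψ f Ω v → tv μ u Set.univ ≤ tv μ v Set.univ

/-- The standing assumptions: `(X,d,μ)` is a complete metric space with at least two points,
`μ` is a doubling measure with constant `Cd`, and `X` supports a `(1,1)`-Poincaré inequality
with constants `CP`, `lam`. -/
structure MMS {X : Type*} [MetricSpace X] [MeasurableSpace X] (μ : Measure X)
    (Cd CP lam : ℝ) : Prop where
  complete : CompleteSpace X
  nontrivial : Nontrivial X
  hCd : 1 ≤ Cd
  hCP : 0 < CP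
  hlam : 1 ≤ lam
  doubling : ∀ (x : X) (r : ℝ), 0 < r →
    0 < μ (Metric.ball x (2 * r)) ∧
    μ (Metric.ball x (2 * r)) ≤ ENNReal.ofReal Cd * μ (Metric.ball x r) ∧
    μ (Metric.ball x r) < ⊤
  poincare : ∀ (x : X) (r : ℝ), 0 < r → ∀ u : X → ℝ, MeasureTheory.LocallyIntegrable u μ →
    ∀ g : X → ℝ≥0∞, Measurable g → IsUpperGradientOn g u Set.univ →
      ∫⁻ y in Metric.ball x r, ENNReal.ofReal |u y - ⨍ z in Metric.ball x r, u z ∂μ| ∂μ ≤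
        ENNReal.ofReal (CP * r) * (μ (Metric.ball x r) / μ (Metric.ball x (lam * r))) *
          ∫⁻ y in Metric.ball x (lam * r), g y ∂μ

/-! ### Calculus along curves -/

omit [MeasurableSpace X] in
lemma speed_congr {γ γ' : ℝ → X} {t : ℝ} (h : γ =ᶠ[𝓝 t] γ') : speed γ t = speed γ' t := by
  have h2 : ∀ᶠ s in 𝓝 (0 : ℝ), γ (t + s) = γ' (t + s) := by
    have : Tendsto (fun s : ℝ => t + s) (𝓝 0) (𝓝 t) := by
      have : Tendsto (fun s : ℝ => t + s) (𝓝 0) (𝓝 (t + 0)) := by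
        exact (continuous_const.add continuous_id).tendsto 0
      simpa using this
    exact this.eventually h
  refine limsup_congr ?_
  filter_upwards [nhdsWithin_le_nhds h2] with s hs
  rw [hs, h.eq_of_nhds]

omit [MeasurableSpace X] in
lemma speed_const {γ : ℝ → X} {t : ℝ} {p : X} (h : γ =ᶠ[𝓝 t] fun _ => p) : speed γ t = 0 := by
  rw [speed_congr h]
  simp [speed]

/-- The subcurve of `γ` over `[a,b]`, parametrized to be constant outside `[a,b]`. -/
def Curve.clamp (γ : Curve X) (a b : ℝ) (ha : 0 ≤ a) (hab : a ≤ b) (hb : b ≤ 1) : Curve X where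
  toFun t := γ.toFun (max a (min b t))
  lipschitz := by
    obtain ⟨K, hK⟩ := γ.lipschitz
    refine ⟨K, fun s _ t _ => ?_⟩
    have hmem : ∀ t : ℝ, max a (min b t) ∈ Icc (0 : ℝ) 1 := fun t =>
      ⟨ha.trans (le_max_left _ _), max_le (hab.trans hb) ((min_le_left _ _).trans hb)⟩
    refine (hK (hmem s) (hmem t)).trans ?_
    gcongr
    have h1 : LipschitzWith 1 (fun t : ℝ => max a (min b t)) :=
      ((LipschitzWith.id.const_min b).const_max a)
    simpa using h1 s t

omit [MeasurableSpace X] in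
lemma curveIntegral_clamp_le (γ : Curve X) {a b : ℝ} (ha : 0 ≤ a) (hab : a ≤ b) (hb : b ≤ 1)
    (g : X → ℝ≥0∞) : curveIntegral g (γ.clamp a b ha hab hb) ≤
      ∫⁻ t in Icc a b, g (γ.toFun t) * speed γ.toFun t := by
  have key : ∀ᵐ t : ℝ, g ((γ.clamp a b ha hab hb).toFun t) *
      speed (γ.clamp a b ha hab hb).toFun t ≤
      (Icc a b).indicator (fun t => g (γ.toFun t) * speed γ.toFun t) t := by
    have h1 : ∀ᵐ t : ℝ, t ≠ a := by simp [ae_iff, measure_singleton]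
    have h2 : ∀ᵐ t : ℝ, t ≠ b := by simp [ae_iff, measure_singleton]
    filter_upwards [h1, h2] with t hta htb
    rcases lt_or_gt_of_ne hta with h | h
    · rw [speed_const (p := γ.toFun a)]
      · simp
      · filter_upwards [Iio_mem_nhds h] with s hs
        change γ.toFun _ = _
        rw [max_eq_left]
        exact (min_le_right _ _).trans (le_of_lt hs)
    rcases lt_or_gt_of_ne htb with h' | h'
    · rw [indicator_of_mem (show t ∈ Icc a b from ⟨h.le, h'.le⟩)]
      have : (γ.clamp a b ha hab hb).toFun =ᶠ[𝓝 t] γ.toFun := by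
        filter_upwards [Ioo_mem_nhds h h'] with s hs
        change γ.toFun _ = _
        rw [min_eq_right hs.2.le, max_eq_right hs.1.le]
      rw [speed_congr this, this.eq_of_nhds]
    · rw [speed_const (p := γ.toFun b)]
      · simp
      · filter_upwards [Ioi_mem_nhds h'] with s hs
        change γ.toFun _ = _
        rw [min_eq_left (le_of_lt hs), max_eq_right hab]
  calc curveIntegral g (γ.clamp a b ha hab hb)
      ≤ ∫⁻ t, g ((γ.clamp a b ha hab hb).toFun t) *
      speed (γ.clamp a b ha hab hb).toFun t := setLIntegral_le_lintegral _ _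
    _ ≤ ∫⁻ t, (Icc a b).indicator (fun t => g (γ.toFun t) * speed γ.toFun t) t :=
      lintegral_mono_ae key
    _ = _ := lintegral_indicator measurableSet_Icc _

omit [MeasurableSpace X] in
lemma IsUpperGradientOn.subcurve {g : X → ℝ≥0∞} {u : X → ℝ} {U : Set X}
    (h : IsUpperGradientOn g u U) (γ : Curve X) {a b : ℝ} (ha : 0 ≤ a) (hab : a ≤ b) (hb : b ≤ 1)
    (hU : ∀ t ∈ Icc a b, γ.toFun t ∈ U) :
    ENNReal.ofReal |u (γ.toFun b) - u (γ.toFun a)| ≤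
      ∫⁻ t in Icc a b, g (γ.toFun t) * speed γ.toFun t := by
  refine le_trans ?_ (curveIntegral_clamp_le γ ha hab hb g)
  have := h (γ.clamp a b ha hab hb) (fun t _ => hU _
    ⟨le_max_left _ _, max_le hab (min_le_left _ _)⟩)
  refine le_trans (le_of_eq ?_) this
  have e1 : (γ.clamp a b ha hab hb).toFun 1 = γ.toFun b := by
    change γ.toFun _ = _
    rw [min_eq_left hb, max_eq_right hab]
  have e0 : (γ.clamp a b ha hab hb).toFun 0 = γ.toFun a := by
    change γ.toFun _ = _
    rw [min_eq_right (ha.trans hab), max_eq_left ha]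
  rw [e0, e1]

/-- The difference quotients of `φ` at `t` are asymptotically bounded by `c`. -/
def SlopeBound (φ : ℝ → ℝ) (t c : ℝ) : Prop :=
  ∀ ε > 0, ∀ᶠ s in 𝓝 t, |φ s - φ t| ≤ (c + ε) * |s - t|

lemma exists_measurable_le_setLIntegral_Icc_eq (G : ℝ → ℝ≥0∞)
    (hG : ∫⁻ t in Icc (0 : ℝ) 1, G t < ⊤) :
    ∃ G' : ℝ → ℝ≥0∞, Measurable G' ∧ G' ≤ G ∧ ∫⁻ t in Icc (0 : ℝ) 1, G' t < ⊤ ∧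
      ∀ a b : ℝ, 0 ≤ a → b ≤ 1 → ∫⁻ t in Icc a b, G t ≤ ∫⁻ t in Icc a b, G' t := by
  obtain ⟨G', hm, hle, heq⟩ := exists_measurable_le_lintegral_eq (volume.restrict (Icc (0 : ℝ) 1)) G
  refine ⟨G', hm, hle, heq ▸ hG, fun a b ha hb => ?_⟩
  set ν := (volume.restrict (Icc (0 : ℝ) 1)) with hν
  have hsub : Icc a b ⊆ Icc (0 : ℝ) 1 := Icc_subset_Icc ha hb
  have hr : volume.restrict (Icc a b) = ν.restrict (Icc a b) := by
    rw [hν, Measure.restrict_restrict measurableSet_Icc, inter_eq_left.2 hsub]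
  rw [hr]
  have h1 := lintegral_add_compl (μ := ν) G (measurableSet_Icc (a := a) (b := b))
  have h2 := lintegral_add_compl (μ := ν) G' (measurableSet_Icc (a := a) (b := b))
  have h3 : ∫⁻ t in (Icc a b)ᶜ, G' t ∂ν ≤ ∫⁻ t in (Icc a b)ᶜ, G t ∂ν := lintegral_mono hle
  have h4 : ∫⁻ t in (Icc a b)ᶜ, G t ∂ν ≠ ⊤ :=
    ((setLIntegral_le_lintegral _ _).trans_lt hG).ne
  have h5 : ∫⁻ t in (Icc a b), G t ∂ν + ∫⁻ t in (Icc a b)ᶜ, G t ∂ν ≤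
      ∫⁻ t in (Icc a b), G' t ∂ν + ∫⁻ t in (Icc a b)ᶜ, G t ∂ν := by
    rw [h1, heq, ← h2]; gcongr
  exact (ENNReal.add_le_add_iff_right h4).1 h5

omit [MeasurableSpace X] in
lemma Curve.continuousAt (γ : Curve X) {t : ℝ} (ht : t ∈ Ioo (0 : ℝ) 1) :
    ContinuousAt γ.toFun t := by
  obtain ⟨K, hK⟩ := γ.lipschitz
  exact hK.continuousOn.continuousAt (Icc_mem_nhds ht.1 ht.2)

omit [MeasurableSpace X] in
lemma IsUpperGradientOn.ae_slopeBound {g : X → ℝ≥0∞} {u : X → ℝ} {U : Set X}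
    (h : IsUpperGradientOn g u U) (hU : IsOpen U) (γ : Curve X) (hfin : curveIntegral g γ < ⊤) :
    ∀ᵐ t : ℝ, t ∈ Ioo (0 : ℝ) 1 → γ.toFun t ∈ U → ∃ c : ℝ, 0 ≤ c ∧
      ENNReal.ofReal c ≤ g (γ.toFun t) * speed γ.toFun t ∧
      SlopeBound (fun s => u (γ.toFun s)) t c := by
  obtain ⟨G', hm, hle, hfin', hIcc⟩ := exists_measurable_le_setLIntegral_Icc_eq
    (fun t => g (γ.toFun t) * speed γ.toFun t) hfin
  set H : ℝ → ℝ := (Icc (0 : ℝ) 1).indicator (fun t => (G' t).toReal) with hH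
  have hint : IntegrableOn (fun t => (G' t).toReal) (Icc (0 : ℝ) 1) :=
    integrable_toReal_of_lintegral_ne_top hm.aemeasurable hfin'.ne
  have hHint : Integrable H := (integrable_indicator_iff measurableSet_Icc).2 hint
  set F : ℝ → ℝ := fun s => ∫ t in (0 : ℝ)..s, H t with hF
  have hFd : ∀ a b : ℝ, 0 ≤ a → a ≤ b → b ≤ 1 → (∀ t ∈ Icc a b, γ.toFun t ∈ U) →
      |u (γ.toFun b) - u (γ.toFun a)| ≤ F b - F a := by
    intro a b ha hab hb hγ
    have e1 : F b - F a = ∫ t in a..b, H t :=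
      intervalIntegral.integral_interval_sub_left hHint.intervalIntegrable
        hHint.intervalIntegrable
    have e2 : ∫ t in a..b, H t = ∫ t in Icc a b, (G' t).toReal := by
      rw [intervalIntegral.integral_of_le hab, ← integral_Icc_eq_integral_Ioc]
      refine setIntegral_congr_fun measurableSet_Icc fun t ht => ?_
      exact indicator_of_mem (Icc_subset_Icc ha hb ht) _
    have hlt : ∫⁻ t in Icc a b, G' t < ⊤ :=
      (lintegral_mono_set (Icc_subset_Icc ha hb)).trans_lt hfin'
    have e3 : ∫ t in Icc a b, (G' t).toReal = (∫⁻ t in Icc a b, G' t).toReal :=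
      integral_toReal hm.aemeasurable (ae_lt_top hm hlt.ne)
    rw [e1, e2, e3]
    refine (ENNReal.ofReal_le_iff_le_toReal hlt.ne).1 ?_
    exact (h.subcurve γ ha hab hb hγ).trans (hIcc a b ha hb)
  filter_upwards [_root_.LocallyIntegrable.ae_hasDerivAt_integral hHint.locallyIntegrable] with t hd ht htU
  refine ⟨H t, indicator_nonneg (fun _ _ => ENNReal.toReal_nonneg) _, ?_, ?_⟩
  · rw [hH, indicator_of_mem (Ioo_subset_Icc_self ht)]
    exact ENNReal.ofReal_toReal_le.trans (hle t)
  intro ε hε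
  have hd0 := hd 0
  have hc := γ.continuousAt ht
  have hnb : ∀ᶠ s in 𝓝 t, s ∈ Ioo (0 : ℝ) 1 ∧ γ.toFun s ∈ U :=
    Filter.Eventually.and (Ioo_mem_nhds ht.1 ht.2) (hc.eventually (hU.mem_nhds htU))
  obtain ⟨δ, hδ, hball⟩ := Metric.eventually_nhds_iff_ball.1 hnb
  have hslope := hasDerivAt_iff_isLittleO.1 hd0
  have hsl := hslope.def hε
  filter_upwards [hsl, Metric.ball_mem_nhds t hδ] with s hs hsb
  have hH0 : 0 ≤ H t := indicator_nonneg (fun _ _ => ENNReal.toReal_nonneg) _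
  have hseg : ∀ r ∈ uIcc t s, γ.toFun r ∈ U := fun r hr =>
    (hball r ((convex_ball t δ).ordConnected.uIcc_subset (mem_ball_self hδ) hsb hr)).2
  have hs01 := (hball s hsb).1
  have hmain : |u (γ.toFun s) - u (γ.toFun t)| ≤ |F s - F t| := by
    rcases le_total t s with hts | hts
    · rw [uIcc_of_le hts] at hseg
      exact (hFd t s ht.1.le hts hs01.2.le hseg).trans (le_abs_self _)
    · rw [uIcc_of_ge hts] at hseg
      rw [abs_sub_comm, abs_sub_comm (F s)]
      exact (hFd s t hs01.1.le hts ht.2.le hseg).trans (le_abs_self _)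
  refine hmain.trans ?_
  simp only [smul_eq_mul, Real.norm_eq_abs] at hs
  have : F s - F t = (F s - F t - (s - t) * H t) + (s - t) * H t := by ring
  rw [this]
  refine (abs_add_le _ _).trans ?_
  rw [abs_mul (s - t), abs_of_nonneg hH0]
  linarith

omit [MeasurableSpace X] in
lemma Curve.lipschitz_comp (γ : Curve X) {v : X → ℝ} {U : Set X} (hv : LocLipschitzOn v U)
    (hU : γ.In U) : ∃ K : ℝ≥0, LipschitzOnWith K (fun t => v (γ.toFun t)) (Icc 0 1) := by
  obtain ⟨K, hK⟩ := γ.lipschitz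
  obtain ⟨L, hL⟩ := hv (γ.toFun '' Icc 0 1) (isCompact_Icc.image_of_continuousOn hK.continuousOn)
    (by rintro _ ⟨t, ht, rfl⟩; exact hU t ht)
  exact ⟨L * K, hL.comp hK (mapsTo_image _ _)⟩

omit [MeasurableSpace X] in
lemma Curve.ae_differentiableAt (γ : Curve X) {v : X → ℝ} (hv : LocLipschitzOn v univ) :
    ∀ᵐ t : ℝ, t ∈ Ioo (0 : ℝ) 1 → DifferentiableAt ℝ (fun t => v (γ.toFun t)) t := by
  obtain ⟨K, hK⟩ := γ.lipschitz_comp hv (fun _ _ => mem_univ _)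
  filter_upwards [hK.ae_differentiableWithinAt_of_mem_real] with t ht h
  exact (ht (Ioo_subset_Icc_self h)).differentiableAt (Icc_mem_nhds h.1 h.2)

omit [MeasurableSpace X] in
lemma Curve.ofReal_abs_sub_le (γ : Curve X) {v : X → ℝ} (hv : LocLipschitzOn v univ)
    {H : X → ℝ≥0∞} (hH : ∀ᵐ t : ℝ, t ∈ Ioo (0 : ℝ) 1 → ∀ d : ℝ,
      HasDerivAt (fun s => v (γ.toFun s)) d t →
        ENNReal.ofReal |d| ≤ H (γ.toFun t) * speed γ.toFun t) :
    ENNReal.ofReal |v (γ.toFun 1) - v (γ.toFun 0)| ≤ curveIntegral H γ := by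
  obtain ⟨K, hK⟩ := γ.lipschitz_comp hv (fun _ _ => mem_univ _)
  have hac : AbsolutelyContinuousOnInterval (fun t => v (γ.toFun t)) 0 1 :=
    LipschitzOnWith.absolutelyContinuousOnInterval (K := K) (by rwa [uIcc_of_le zero_le_one])
  have hftc := hac.integral_deriv_eq_sub
  have hae := γ.ae_differentiableAt hv
  rw [← hftc, intervalIntegral.integral_of_le zero_le_one, integral_Ioc_eq_integral_Ioo]
  rw [← Real.norm_eq_abs, ofReal_norm]
  refine (enorm_integral_le_lintegral_enorm _).trans ?_
  refine le_trans ?_ (lintegral_mono_set Ioo_subset_Icc_self)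
  refine lintegral_mono_ae ?_
  refine (ae_restrict_iff' measurableSet_Ioo).2 ?_
  filter_upwards [hH, hae] with t h1 h2 ht
  have := h1 ht _ (h2 ht).hasDerivAt
  rwa [← Real.norm_eq_abs, ofReal_norm] at this

omit [MeasurableSpace X] in
lemma Curve.slopeBound_dist (γ : Curve X) {t : ℝ} (ht : t ∈ Ioo (0 : ℝ) 1) :
    ∃ c : ℝ, 0 ≤ c ∧ ENNReal.ofReal c = speed γ.toFun t ∧
      ∀ ε > 0, ∀ᶠ s in 𝓝 t, dist (γ.toFun s) (γ.toFun t) ≤ (c + ε) * |s - t| := by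
  obtain ⟨K, hK⟩ := γ.lipschitz
  have hadd : Tendsto (fun s : ℝ => t + s) (𝓝 0) (𝓝 t) := by
    simpa using (continuous_const.add continuous_id).tendsto (0 : ℝ) (f := fun s : ℝ => t + s)
  have hsub : Tendsto (fun s : ℝ => s - t) (𝓝 t) (𝓝 0) := by
    simpa using (continuous_id.sub continuous_const).tendsto t (f := fun s : ℝ => s - t)
  have hfin : speed γ.toFun t < ⊤ := by
    refine lt_of_le_of_lt (limsup_le_of_le (h := ?_) (a := ENNReal.ofReal K)) ENNReal.ofReal_lt_top
    filter_upwards [nhdsWithin_le_nhds (hadd.eventually (Icc_mem_nhds ht.1 ht.2)),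
      self_mem_nhdsWithin] with s hs hs0
    refine ENNReal.ofReal_le_ofReal ?_
    rw [div_le_iff₀ (abs_pos.2 hs0)]
    have := hK.dist_le_mul _ hs _ (Ioo_subset_Icc_self ht)
    simpa [Real.dist_eq] using this
  refine ⟨(speed γ.toFun t).toReal, ENNReal.toReal_nonneg, ENNReal.ofReal_toReal hfin.ne, ?_⟩
  intro ε hε
  have hlt : speed γ.toFun t < ENNReal.ofReal ((speed γ.toFun t).toReal + ε) := by
    rw [ENNReal.lt_ofReal_iff_toReal_lt hfin.ne]; linarith
  have hev := eventually_lt_of_limsup_lt hlt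
  rw [eventually_nhdsWithin_iff] at hev
  filter_upwards [hsub.eventually hev] with s hs
  by_cases hst : s = t
  · simp [hst]
  · have h0 : s - t ≠ 0 := sub_ne_zero.2 hst
    have h1 := hs h0
    rw [add_sub_cancel] at h1
    have h2 := (ENNReal.ofReal_lt_ofReal_iff (by positivity)).1 h1
    exact ((div_lt_iff₀ (abs_pos.2 h0)).1 h2).le

lemma SlopeBound.abs_le {φ : ℝ → ℝ} {t c d : ℝ} (h : SlopeBound φ t c) (hd : HasDerivAt φ d t) :
    |d| ≤ c := by
  refine le_of_forall_pos_le_add fun ε hε => ?_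
  have h1 : Tendsto (fun s => |slope φ t s|) (𝓝[≠] t) (𝓝 |d|) :=
    (hasDerivAt_iff_tendsto_slope.1 hd).abs
  refine le_of_tendsto h1 ?_
  filter_upwards [nhdsWithin_le_nhds (h ε hε), self_mem_nhdsWithin] with s hs hst
  have h0 : 0 < |s - t| := abs_pos.2 (sub_ne_zero.2 hst)
  rw [slope_def_field, abs_div, div_le_iff₀ h0]
  exact hs

/-! ### Weak upper gradients -/

omit [MeasurableSpace X] in
lemma curveIntegral_mono {g g' : X → ℝ≥0∞} (h : ∀ x, g x ≤ g' x) (γ : Curve X) :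
    curveIntegral g γ ≤ curveIntegral g' γ :=
  lintegral_mono fun t => by gcongr; exact h _

omit [MeasurableSpace X] in
lemma sum_curveIntegral_le (ρ : ℕ → X → ℝ≥0∞) (γ : Curve X) (s : Finset ℕ) :
    ∑ n ∈ s, curveIntegral (ρ n) γ ≤ curveIntegral (fun x => ∑ n ∈ s, ρ n x) γ := by
  induction s using Finset.induction_on with
  | empty => simp
  | insert n s hn ih =>
    rw [Finset.sum_insert hn]
    refine (add_le_add le_rfl ih).trans ((le_lintegral_add _ _).trans ?_)
    refine lintegral_mono fun t => ?_
    simp only [Finset.sum_insert hn, add_mul]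
    exact le_rfl

lemma exists_curveIntegral_eq_top {μ : Measure X} {Γ : Set (Curve X)} (h : Mod1 μ Γ = 0)
    {ε : ℝ≥0∞} (hε : ε ≠ 0) : ∃ σ : X → ℝ≥0∞, Measurable σ ∧ ∫⁻ x, σ x ∂μ ≤ ε ∧
      ∀ γ ∈ Γ, curveIntegral σ γ = ⊤ := by
  obtain ⟨δ, hδ0, hδ⟩ := ENNReal.exists_pos_sum_of_countable' hε ℕ
  have hex : ∀ n, ∃ ρ : X → ℝ≥0∞, Measurable ρ ∧ (∀ γ ∈ Γ, 1 ≤ curveIntegral ρ γ) ∧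
      ∫⁻ x, ρ x ∂μ < δ n := by
    intro n
    have hlt : Mod1 μ Γ < δ n := h ▸ hδ0 n
    simp only [Mod1, iInf_lt_iff] at hlt
    obtain ⟨ρ, hm, hρ, hlt⟩ := hlt
    exact ⟨ρ, hm, hρ, hlt⟩
  choose ρ hm hρ hlt using hex
  refine ⟨fun x => ∑' n, ρ n x, Measurable.tsum hm, ?_, fun γ hγ => ?_⟩
  · rw [lintegral_tsum fun n => (hm n).aemeasurable]
    exact (ENNReal.tsum_le_tsum fun n => (hlt n).le).trans hδ.le
  · refine ENNReal.eq_top_of_forall_nnreal_le fun r => ?_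
    obtain ⟨N, hN⟩ := exists_nat_ge r
    calc (r : ℝ≥0∞) ≤ (N : ℝ≥0∞) := by exact_mod_cast hN
      _ = ∑ n ∈ Finset.range N, (1 : ℝ≥0∞) := by simp
      _ ≤ ∑ n ∈ Finset.range N, curveIntegral (ρ n) γ := Finset.sum_le_sum fun n _ => hρ n γ hγ
      _ ≤ curveIntegral (fun x => ∑ n ∈ Finset.range N, ρ n x) γ := sum_curveIntegral_le _ _ _
      _ ≤ _ := curveIntegral_mono (fun x => ENNReal.sum_le_tsum _) γ

lemma IsWeakUpperGradientOn.exists_isUpperGradientOn {μ : Measure X} {g : X → ℝ≥0∞} {u : X → ℝ}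
    {U : Set X} (h : IsWeakUpperGradientOn μ g u U) {ε : ℝ≥0∞} (hε : ε ≠ 0) :
    ∃ σ : X → ℝ≥0∞, Measurable σ ∧ ∫⁻ x, σ x ∂μ ≤ ε ∧
      IsUpperGradientOn (fun x => g x + σ x) u U := by
  obtain ⟨Γ, hΓ, hu⟩ := h
  obtain ⟨σ, hm, hσ, htop⟩ := exists_curveIntegral_eq_top hΓ hε
  refine ⟨σ, hm, hσ, fun γ hγ => ?_⟩
  by_cases hmem : γ ∈ Γ
  · have : curveIntegral σ γ ≤ curveIntegral (fun x => g x + σ x) γ :=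
      curveIntegral_mono (fun x => le_add_self) γ
    rw [htop γ hmem, top_le_iff] at this
    rw [this]; exact le_top
  · exact (hu γ hmem hγ).trans (curveIntegral_mono (fun x => le_self_add) γ)

lemma Mod1_curveIntegral_eq_top {μ : Measure X} {G : X → ℝ≥0∞} (hG : Measurable G)
    (hfin : ∫⁻ x, G x ∂μ ≠ ⊤) : Mod1 μ {γ | curveIntegral G γ = ⊤} = 0 := by
  have hle : ∀ δ : ℝ≥0, 0 < δ → Mod1 μ {γ | curveIntegral G γ = ⊤} ≤ δ * ∫⁻ x, G x ∂μ := by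
    intro δ hδ
    rw [← lintegral_const_mul _ hG]
    refine iInf₂_le_of_le (fun x => (δ : ℝ≥0∞) * G x) (hG.const_mul _) ?_
    refine iInf_le_of_le (fun γ hγ => ?_) le_rfl
    have h1 : (δ : ℝ≥0∞) * curveIntegral G γ ≤ curveIntegral (fun x => (δ : ℝ≥0∞) * G x) γ := by
      refine (lintegral_const_mul_le _ _).trans (le_of_eq ?_)
      simp only [mul_assoc, curveIntegral]
    rw [show curveIntegral G γ = ⊤ from hγ, ENNReal.mul_top (by exact_mod_cast hδ.ne')] at h1
    exact le_top.trans h1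
  refine le_antisymm ?_ zero_le
  lift ∫⁻ x, G x ∂μ to ℝ≥0 using hfin with I
  refine ENNReal.le_of_forall_pos_le_add fun ε hε _ => ?_
  have := hle (ε / (I + 1)) (by positivity)
  rw [zero_add]
  refine this.trans ?_
  rw [← ENNReal.coe_mul, ENNReal.coe_le_coe, div_mul_eq_mul_div]
  exact div_le_of_le_mul₀ zero_le zero_le (by gcongr; simp)

omit [MeasurableSpace X] in
lemma IsUpperGradientOn.neg {g : X → ℝ≥0∞} {u : X → ℝ} {U : Set X}
    (h : IsUpperGradientOn g u U) : IsUpperGradientOn g (fun x => -u x) U := by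
  intro γ hγ
  have := h γ hγ
  rwa [show -u (γ.toFun 1) - -u (γ.toFun 0) = -(u (γ.toFun 1) - u (γ.toFun 0)) by ring, abs_neg]

omit [MeasurableSpace X] in
lemma IsUpperGradientOn.indicator {g : X → ℝ≥0∞} {u : X → ℝ} {U : Set X}
    (h : IsUpperGradientOn g u U) : IsUpperGradientOn (U.indicator g) u U := by
  intro γ hγ
  refine (h γ hγ).trans (le_of_eq ?_)
  refine setLIntegral_congr_fun measurableSet_Icc fun t ht => ?_
  simp only [indicator_of_mem (hγ t ht)]

omit [MeasurableSpace X] in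
lemma LocLipschitzOn.max_const {u : X → ℝ} {U : Set X} (hu : LocLipschitzOn u U) (k : ℝ) :
    LocLipschitzOn (fun x => max (u x) k) U := by
  intro K hK hKU
  obtain ⟨L, hL⟩ := hu K hK hKU
  refine ⟨L, LipschitzOnWith.of_dist_le_mul fun p hp q hq => ?_⟩
  exact (abs_max_sub_max_le_abs _ _ _).trans (hL.dist_le_mul p hp q hq)

omit [MeasurableSpace X] in
lemma LocLipschitzOn.neg {u : X → ℝ} {U : Set X} (hu : LocLipschitzOn u U) :
    LocLipschitzOn (fun x => -u x) U := by
  intro K hK hKU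
  obtain ⟨L, hL⟩ := hu K hK hKU
  exact ⟨L, hL.neg⟩

lemma IsUpperGradientOn.max_const {μ : Measure X} {g : X → ℝ≥0∞} {u : X → ℝ}
    (h : IsUpperGradientOn g u univ) (hu : LocLipschitzOn u univ) (hg : Measurable g)
    (hfin : ∫⁻ x, g x ∂μ ≠ ⊤) (k : ℝ) :
    IsWeakUpperGradientOn μ ({x | k < u x}.indicator g) (fun x => max (u x) k) univ := by
  refine ⟨_, Mod1_curveIntegral_eq_top hg hfin, fun γ hγ _ => ?_⟩
  refine γ.ofReal_abs_sub_le (v := fun x => max (u x) k) (hu.max_const k) ?_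
  obtain ⟨K, hK⟩ := γ.lipschitz_comp hu (fun _ _ => mem_univ _)
  filter_upwards [h.ae_slopeBound isOpen_univ γ (lt_top_iff_ne_top.2 hγ)] with t hs ht d hd
  obtain ⟨c, hc0, hc, hsb⟩ := hs ht (mem_univ _)
  rcases le_or_gt (u (γ.toFun t)) k with hk | hk
  · have hmin : IsLocalMin (fun s => max (u (γ.toFun s)) k) t := by
      refine Eventually.of_forall fun s => ?_
      simp only [max_eq_right hk]
      exact le_max_right _ _
    rw [hmin.hasDerivAt_eq_zero hd]; simp
  · have hcont : ContinuousAt (fun s => u (γ.toFun s)) t :=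
      hK.continuousOn.continuousAt (Icc_mem_nhds ht.1 ht.2)
    have hev : (fun s => max (u (γ.toFun s)) k) =ᶠ[𝓝 t] fun s => u (γ.toFun s) := by
      filter_upwards [hcont.eventually (lt_mem_nhds hk)] with s hs
      exact max_eq_left hs.le
    have hd' := hd.congr_of_eventuallyEq hev.symm
    rw [indicator_of_mem (show γ.toFun t ∈ {x | k < u x} from hk)]
    exact (ENNReal.ofReal_le_ofReal (hsb.abs_le hd')).trans hc

lemma IsUpperGradientOn.min_const {μ : Measure X} {g : X → ℝ≥0∞} {u : X → ℝ}
    (h : IsUpperGradientOn g u univ) (hu : LocLipschitzOn u univ) (hg : Measurable g)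
    (hfin : ∫⁻ x, g x ∂μ ≠ ⊤) (k : ℝ) :
    IsWeakUpperGradientOn μ ({x | u x < k}.indicator g) (fun x => min (u x) k) univ := by
  obtain ⟨Γ, hΓ, hw⟩ := h.neg.max_const hu.neg hg hfin (-k)
  refine ⟨Γ, hΓ, fun γ hγ hU => ?_⟩
  have := hw γ hγ hU
  simp only [max_neg_neg, neg_lt_neg_iff] at this
  rwa [show -min (u (γ.toFun 1)) k - -min (u (γ.toFun 0)) k =
    -(min (u (γ.toFun 1)) k - min (u (γ.toFun 0)) k) by ring, abs_neg] at this

lemma SlopeBound.leibniz {η a b : ℝ → ℝ} {t ca cb ce : ℝ} (ha : SlopeBound a t ca)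
    (hb : SlopeBound b t cb) (he : SlopeBound η t ce) (hca : 0 ≤ ca) (hcb : 0 ≤ cb)
    (hη0 : ∀ s, 0 ≤ η s) (hη1 : ∀ s, η s ≤ 1) (hηc : ContinuousAt η t) :
    SlopeBound (fun s => η s * a s + (1 - η s) * b s) t
      (η t * ca + (1 - η t) * cb + |a t - b t| * ce) := by
  intro ε hε
  set D := |a t - b t| with hD
  have hD0 : 0 ≤ D := abs_nonneg _
  set δ := ε / (1 + ca + cb + D) with hδ
  have hδ0 : 0 < δ := by positivity
  have hδe : δ * (1 + ca + cb + D) = ε := by rw [hδ]; field_simp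
  filter_upwards [ha δ hδ0, hb δ hδ0, he δ hδ0, Metric.continuousAt_iff'.1 hηc δ hδ0]
    with s h1 h2 h3 h4
  rw [Real.dist_eq] at h4
  have e : η s * a s + (1 - η s) * b s - (η t * a t + (1 - η t) * b t) =
    η s * (a s - a t) + (1 - η s) * (b s - b t) + (η s - η t) * (a t - b t) := by ring
  have hs0 := hη0 s
  have hs1 : 0 ≤ 1 - η s := sub_nonneg.2 (hη1 s)
  have h5 : |η s * a s + (1 - η s) * b s - (η t * a t + (1 - η t) * b t)| ≤
      η s * |a s - a t| + (1 - η s) * |b s - b t| + |η s - η t| * D := by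
    rw [e]
    refine (abs_add_three _ _ _).trans (le_of_eq ?_)
    rw [abs_mul, abs_mul, abs_mul, abs_of_nonneg hs0, abs_of_nonneg hs1]
  refine h5.trans ?_
  obtain ⟨h6, h7⟩ := abs_lt.1 h4
  have hst : 0 ≤ |s - t| := abs_nonneg _
  calc η s * |a s - a t| + (1 - η s) * |b s - b t| + |η s - η t| * D
      ≤ η s * ((ca + δ) * |s - t|) + (1 - η s) * ((cb + δ) * |s - t|) +
        ((ce + δ) * |s - t|) * D := by gcongr
    _ = (η s * ca + (1 - η s) * cb + δ + (ce + δ) * D) * |s - t| := by ring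
    _ ≤ ((η t + δ) * ca + (1 - η t + δ) * cb + δ + (ce + δ) * D) * |s - t| := by
      gcongr <;> linarith
    _ = (η t * ca + (1 - η t) * cb + D * ce + δ * (1 + ca + cb + D)) * |s - t| := by ring
    _ = _ := by rw [hδe]

lemma SlopeBound.congr {φ ψ : ℝ → ℝ} {t c : ℝ} (h : SlopeBound φ t c) (he : φ =ᶠ[𝓝 t] ψ) :
    SlopeBound ψ t c := by
  intro ε hε
  filter_upwards [h ε hε, he] with s hs hse
  rwa [← hse, ← he.eq_of_nhds]

lemma SlopeBound.of_eventually_const {φ : ℝ → ℝ} {t : ℝ} (h : ∀ᶠ s in 𝓝 t, φ s = φ t) :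
    SlopeBound φ t 0 := by
  intro ε hε
  filter_upwards [h] with s hs
  rw [hs, sub_self, abs_zero]; positivity

/-- The gluing gradient for `η a + (1 - η) b`. -/
def glueGrad (η a b : X → ℝ) (L : ℝ≥0) (S : Set X) (ga gb : X → ℝ≥0∞) : X → ℝ≥0∞ := fun z =>
  ENNReal.ofReal (η z) * ga z + ENNReal.ofReal (1 - η z) * gb z +
    S.indicator (fun z => ENNReal.ofReal (|a z - b z| * L)) z

omit [MeasurableSpace X] in
lemma Curve.slopeBound_cutoff (γ : Curve X) {η : X → ℝ} {L : ℝ≥0} {S : Set X}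
    (hηL : LipschitzWith L η) (hS : ∀ z ∉ S, ∀ᶠ y in 𝓝 z, η y = η z) {t : ℝ}
    (ht : t ∈ Ioo (0 : ℝ) 1) : ∃ c : ℝ, 0 ≤ c ∧
      ENNReal.ofReal c ≤ S.indicator (fun _ => (L : ℝ≥0∞)) (γ.toFun t) * speed γ.toFun t ∧
      SlopeBound (fun s => η (γ.toFun s)) t c := by
  by_cases hzS : γ.toFun t ∈ S
  · obtain ⟨c, hc0, hc, hd⟩ := γ.slopeBound_dist ht
    refine ⟨L * c, by positivity, ?_, fun ε hε => ?_⟩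
    · rw [indicator_of_mem hzS, ← hc, ENNReal.ofReal_mul L.coe_nonneg, ENNReal.ofReal_coe_nnreal]
    · have hpos : 0 < ε / (L + 1) := by positivity
      filter_upwards [hd _ hpos] with s hs
      have h1 := hηL.dist_le_mul (γ.toFun s) (γ.toFun t)
      rw [Real.dist_eq] at h1
      refine h1.trans ?_
      have h2 : (L : ℝ) * (ε / (L + 1)) ≤ ε := by
        rw [mul_div_assoc', div_le_iff₀ (by positivity)]; nlinarith [L.coe_nonneg]
      calc (L : ℝ) * dist (γ.toFun s) (γ.toFun t) ≤ L * ((c + ε / (L + 1)) * |s - t|) := by gcongr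
        _ = (L * c + L * (ε / (L + 1))) * |s - t| := by ring
        _ ≤ _ := by gcongr
  · refine ⟨0, le_rfl, by simp, SlopeBound.of_eventually_const ?_⟩
    exact (γ.continuousAt ht).eventually (hS _ hzS)

lemma isWeakUpperGradientOn_glue {μ : Measure X} {η a b : X → ℝ} {L : ℝ≥0} {S U : Set X}
    {ga gb : X → ℝ≥0∞} (hU : IsOpen U) (hηL : LipschitzWith L η) (hη0 : ∀ z, 0 ≤ η z)
    (hη1 : ∀ z, η z ≤ 1) (hS : ∀ z ∉ S, ∀ᶠ y in 𝓝 z, η y = η z)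
    (hηU : tsupport η ⊆ U) (ha : IsUpperGradientOn ga a U) (hb : IsUpperGradientOn gb b univ)
    (hga : Measurable ga) (hgb : Measurable gb) (hga' : ∫⁻ x, ga x ∂μ ≠ ⊤)
    (hgb' : ∫⁻ x, gb x ∂μ ≠ ⊤)
    (hv : LocLipschitzOn (fun z => η z * a z + (1 - η z) * b z) univ) :
    IsWeakUpperGradientOn μ (glueGrad η a b L S ga gb)
      (fun z => η z * a z + (1 - η z) * b z) univ := by
  have hsum : ∫⁻ x, (ga x + gb x) ∂μ ≠ ⊤ := by
    rw [lintegral_add_left hga]; exact ENNReal.add_ne_top.2 ⟨hga', hgb'⟩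
  refine ⟨_, Mod1_curveIntegral_eq_top (hga.add hgb) hsum, fun γ hγ _ => ?_⟩
  have hγa : curveIntegral ga γ < ⊤ :=
    (curveIntegral_mono (fun x => le_self_add) γ).trans_lt (lt_top_iff_ne_top.2 hγ)
  have hγb : curveIntegral gb γ < ⊤ :=
    (curveIntegral_mono (fun x => le_add_self) γ).trans_lt (lt_top_iff_ne_top.2 hγ)
  refine γ.ofReal_abs_sub_le (v := fun z => η z * a z + (1 - η z) * b z) hv ?_
  filter_upwards [ha.ae_slopeBound hU γ hγa, hb.ae_slopeBound isOpen_univ γ hγb]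
    with t hta htb ht d hd
  obtain ⟨cb, hcb0, hcb, hsb⟩ := htb ht (mem_univ _)
  have h1η : 0 ≤ 1 - η (γ.toFun t) := sub_nonneg.2 (hη1 _)
  by_cases hzU : γ.toFun t ∈ U
  · obtain ⟨ca, hca0, hca, hsa⟩ := hta ht hzU
    obtain ⟨ce, hce0, hce, hse⟩ := γ.slopeBound_cutoff hηL hS ht
    have hηc : ContinuousAt (fun s => η (γ.toFun s)) t :=
      hηL.continuous.continuousAt.comp (γ.continuousAt ht)
    have hle := (hsa.leibniz hsb hse hca0 hcb0 (fun s => hη0 _) (fun s => hη1 _) hηc).abs_le hd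
    refine (ENNReal.ofReal_le_ofReal hle).trans ?_
    have hηt := hη0 (γ.toFun t)
    rw [ENNReal.ofReal_add (by positivity) (by positivity),
      ENNReal.ofReal_add (by positivity) (by positivity), ENNReal.ofReal_mul (hη0 _),
      ENNReal.ofReal_mul h1η, ENNReal.ofReal_mul (abs_nonneg _), glueGrad, add_mul, add_mul,
      mul_assoc, mul_assoc]
    refine add_le_add (add_le_add (mul_le_mul_right hca _) (mul_le_mul_right hcb _)) ?_
    refine (mul_le_mul_right hce _).trans (le_of_eq ?_)
    by_cases hzS : γ.toFun t ∈ S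
    · simp only [indicator_of_mem hzS]
      rw [ENNReal.ofReal_mul (abs_nonneg _), ENNReal.ofReal_coe_nnreal, mul_assoc]
    · simp only [indicator_of_notMem hzS]; simp
  · have hz : γ.toFun t ∉ tsupport η := fun h => hzU (hηU h)
    have hev : (fun s => b (γ.toFun s)) =ᶠ[𝓝 t]
        fun s => η (γ.toFun s) * a (γ.toFun s) + (1 - η (γ.toFun s)) * b (γ.toFun s) := by
      have h0 := notMem_tsupport_iff_eventuallyEq.1 hz
      filter_upwards [(γ.continuousAt ht).eventually h0] with s hs
      have hs' : η (γ.toFun s) = 0 := hs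
      rw [hs']; ring
    have hle := (hsb.congr hev).abs_le hd
    refine (ENNReal.ofReal_le_ofReal hle).trans (hcb.trans ?_)
    rw [glueGrad, image_eq_zero_of_notMem_tsupport hz, add_mul, add_mul]
    simp only [sub_zero, ENNReal.ofReal_one, one_mul]
    exact le_add_self.trans le_self_add

omit [MeasurableSpace X] in
lemma LocLipschitzOn.add {a b : X → ℝ} {U : Set X} (ha : LocLipschitzOn a U)
    (hb : LocLipschitzOn b U) : LocLipschitzOn (fun z => a z + b z) U := by
  intro K hK hKU
  obtain ⟨L, hL⟩ := ha K hK hKU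
  obtain ⟨M, hM⟩ := hb K hK hKU
  exact ⟨L + M, hL.add hM⟩

omit [MeasurableSpace X] in
lemma LocLipschitzOn.cutoff_mul {η a : X → ℝ} {L : ℝ≥0} {U : Set X} (ha : LocLipschitzOn a U)
    (hηL : LipschitzWith L η) (hη0 : ∀ z, 0 ≤ η z) (hη1 : ∀ z, η z ≤ 1) (hηU : tsupport η ⊆ U) :
    LocLipschitzOn (fun z => η z * a z) univ := by
  intro K hK _
  have hK' : IsCompact (K ∩ tsupport η) := hK.inter_right (isClosed_tsupport η)
  obtain ⟨A, hA⟩ := ha _ hK' (inter_subset_right.trans hηU)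
  obtain ⟨M, hM⟩ := (hK'.image_of_continuousOn hA.continuousOn).isBounded.exists_norm_le
  set M' : ℝ≥0 := M.toNNReal with hM'
  have hMa : ∀ z ∈ K ∩ tsupport η, |a z| ≤ M' := fun z hz =>
    (hM _ (mem_image_of_mem _ hz)).trans (Real.le_coe_toNNReal M)
  refine ⟨A + L * M', LipschitzOnWith.of_dist_le_mul ?_⟩
  have hone : ∀ p ∈ K, ∀ q ∈ K, q ∉ tsupport η →
      dist (η p * a p) (η q * a q) ≤ (A + L * M' : ℝ≥0) * dist p q := by
    intro p hp q hq hqη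
    rw [image_eq_zero_of_notMem_tsupport hqη, zero_mul, Real.dist_eq, sub_zero, abs_mul]
    by_cases hpη : p ∈ tsupport η
    · have h1 := hηL.dist_le_mul p q
      rw [image_eq_zero_of_notMem_tsupport hqη, Real.dist_eq, sub_zero] at h1
      have h2 := hMa p ⟨hp, hpη⟩
      calc |η p| * |a p| ≤ (L * dist p q) * M' := by gcongr
        _ = (L * M') * dist p q := by ring
        _ ≤ (A + L * M') * dist p q := by gcongr; exact le_add_of_nonneg_left A.coe_nonneg
        _ = _ := by push_cast; ring
    · rw [image_eq_zero_of_notMem_tsupport hpη]; simp; positivity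
  intro p hp q hq
  by_cases hqη : q ∈ tsupport η
  · by_cases hpη : p ∈ tsupport η
    · have h1 := hηL.dist_le_mul p q
      have h2 := hA.dist_le_mul p ⟨hp, hpη⟩ q ⟨hq, hqη⟩
      have h3 := hMa q ⟨hq, hqη⟩
      rw [Real.dist_eq] at h1 h2 ⊢
      have e : η p * a p - η q * a q = η p * (a p - a q) + (η p - η q) * a q := by ring
      rw [e]
      calc |η p * (a p - a q) + (η p - η q) * a q|
          ≤ |η p| * |a p - a q| + |η p - η q| * |a q| := by
            refine (abs_add_le _ _).trans (le_of_eq ?_); rw [abs_mul, abs_mul]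
        _ ≤ 1 * (A * dist p q) + (L * dist p q) * M' := by
            gcongr; rw [abs_of_nonneg (hη0 _)]; exact hη1 _
        _ = _ := by push_cast; ring
    · rw [dist_comm, dist_comm p]; exact hone q hq p hp hpη
  · exact hone p hp q hq hqη

section Doubling

variable {μ : Measure X} {Cd CP lam : ℝ}

lemma MMS.measure_ball_pos (hX : MMS μ Cd CP lam) (x : X) {r : ℝ} (hr : 0 < r) :
    0 < μ (ball x r) := by
  have h := (hX.doubling x (r / 2) (by positivity)).1
  rwa [mul_div_cancel₀ r two_ne_zero] at h

lemma MMS.measure_ball_lt_top (hX : MMS μ Cd CP lam) (x : X) (r : ℝ) : μ (ball x r) < ⊤ := by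
  rcases lt_or_ge 0 r with hr | hr
  · exact (hX.doubling x r hr).2.2
  · simp [ball_eq_empty.2 hr]

lemma MMS.measure_ball_two_pow_le (hX : MMS μ Cd CP lam) (x : X) {r : ℝ} (hr : 0 < r) (n : ℕ) :
    μ (ball x (2 ^ n * r)) ≤ ENNReal.ofReal Cd ^ n * μ (ball x r) := by
  induction n with
  | zero => simp
  | succ n ih =>
    rw [pow_succ', mul_assoc, pow_succ', mul_assoc]
    exact (hX.doubling x (2 ^ n * r) (by positivity)).2.1.trans (mul_le_mul_right ih _)

lemma MMS.measure_ball_le (hX : MMS μ Cd CP lam) {x y : X} {R r : ℝ} (hr : 0 < r) {n : ℕ}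
    (h : R + dist x y ≤ 2 ^ n * r) :
    μ (ball x R) ≤ ENNReal.ofReal Cd ^ n * μ (ball y r) :=
  (measure_mono (ball_subset_ball' h)).trans (hX.measure_ball_two_pow_le y hr n)

lemma MMS.totallyBounded_closedBall [BorelSpace X] (hX : MMS μ Cd CP lam) (x : X) (R : ℝ) :
    TotallyBounded (closedBall x R) := by
  rw [Metric.totallyBounded_iff]
  by_contra! hcon
  obtain ⟨ε, hε, hcon⟩ := hcon
  have hstep : ∀ s : Finset X, (∀ y ∈ s, y ∈ closedBall x R) →
      ∃ y, y ∈ closedBall x R ∧ ∀ z ∈ s, ε ≤ dist y z := by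
    intro s _
    obtain ⟨y, hy, hys⟩ := not_subset.1 (hcon s s.finite_toSet)
    refine ⟨y, hy, fun z hz => ?_⟩
    by_contra! hlt
    exact hys (mem_iUnion₂.2 ⟨z, hz, hlt⟩)
  obtain ⟨f, hf, hsep⟩ := exists_seq_of_forall_finset_exists (fun y => y ∈ closedBall x R)
    (fun z y => ε ≤ dist y z) hstep
  have hdisj : Pairwise (Function.onFun Disjoint fun n => ball (f n) (ε / 2)) := by
    intro m n hmn
    refine ball_disjoint_ball ?_
    rcases lt_or_gt_of_ne hmn with h | h
    · have := hsep _ _ h; rw [dist_comm] at this; linarith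
    · have := hsep _ _ h; linarith
  have hR : 0 ≤ R := (dist_nonneg).trans (hf 0)
  obtain ⟨n, hn⟩ := pow_unbounded_of_one_lt ((R + ε + R) / (ε / 2)) one_lt_two
  have hlow : ∀ i, μ (ball x (R + ε)) ≤ ENNReal.ofReal Cd ^ n * μ (ball (f i) (ε / 2)) := by
    intro i
    refine hX.measure_ball_le (half_pos hε) ?_
    have := hf i
    rw [mem_closedBall, dist_comm] at this
    have h2 := (div_lt_iff₀ (half_pos hε)).1 hn
    linarith
  have hsub : ⋃ i, ball (f i) (ε / 2) ⊆ ball x (R + ε) := by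
    refine iUnion_subset fun i => ball_subset_ball' ?_
    have := hf i
    rw [mem_closedBall] at this
    linarith
  have htop : ENNReal.ofReal Cd ^ n * ∑' i, μ (ball (f i) (ε / 2)) < ⊤ := by
    rw [← measure_iUnion hdisj fun i => measurableSet_ball]
    exact ENNReal.mul_lt_top (by finiteness)
      ((measure_mono hsub).trans_lt (hX.measure_ball_lt_top x _))
  rw [← ENNReal.tsum_mul_left] at htop
  have := (ENNReal.tsum_le_tsum hlow).trans_lt htop
  rw [ENNReal.tsum_const_eq_top_of_ne_zero
    (hX.measure_ball_pos x (by positivity : 0 < R + ε)).ne'] at this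
  exact lt_irrefl _ this

lemma MMS.properSpace [BorelSpace X] (hX : MMS μ Cd CP lam) : ProperSpace X := by
  have := hX.complete
  exact ⟨fun x r => (hX.totallyBounded_closedBall x r).isCompact_of_isClosed isClosed_closedBall⟩

lemma MMS.isLocallyFiniteMeasure (hX : MMS μ Cd CP lam) : IsLocallyFiniteMeasure μ :=
  ⟨fun x => ⟨ball x 1, ball_mem_nhds x one_pos, hX.measure_ball_lt_top x 1⟩⟩

end Doubling

section Sobolev

variable {μ : Measure X} {Cd CP lam : ℝ}

lemma measurable_measure_ball [BorelSpace X] [SecondCountableTopology X] [SFinite μ] (r : ℝ) :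
    Measurable fun y => μ (ball y r) := by
  have h : MeasurableSet {p : X × X | dist p.2 p.1 < r} :=
    (isOpen_lt (continuous_snd.dist continuous_fst) continuous_const).measurableSet
  exact measurable_measure_prodMk_left h

lemma lintegral_mul_lintegral_ball_comm [BorelSpace X] [SecondCountableTopology X] [SFinite μ]
    {Φ F : X → ℝ≥0∞} (hΦ : Measurable Φ) (hF : Measurable F) (s : ℝ) :
    ∫⁻ y, Φ y * ∫⁻ z in ball y s, F z ∂μ ∂μ = ∫⁻ z, F z * ∫⁻ y in ball z s, Φ y ∂μ ∂μ := by
  have h : MeasurableSet {p : X × X | dist p.2 p.1 < s} :=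
    (isOpen_lt (continuous_snd.dist continuous_fst) continuous_const).measurableSet
  have hk : Measurable (fun p : X × X =>
      Φ p.1 * {p : X × X | dist p.2 p.1 < s}.indicator (fun p => F p.2) p) :=
    (hΦ.comp measurable_fst).mul ((hF.comp measurable_snd).indicator h)
  calc ∫⁻ y, Φ y * ∫⁻ z in ball y s, F z ∂μ ∂μ
      = ∫⁻ y, ∫⁻ z, Φ y * {p : X × X | dist p.2 p.1 < s}.indicator (fun p => F p.2) (y, z) ∂μ ∂μ := by
        refine lintegral_congr fun y => ?_
        have hm : Measurable fun z =>
            {p : X × X | dist p.2 p.1 < s}.indicator (fun p => F p.2) (y, z) :=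
          ((hF.comp measurable_snd).indicator h).comp measurable_prodMk_left
        rw [lintegral_const_mul _ hm, ← lintegral_indicator measurableSet_ball]
        rfl
    _ = ∫⁻ z, ∫⁻ y, Φ y * {p : X × X | dist p.2 p.1 < s}.indicator (fun p => F p.2) (y, z) ∂μ ∂μ :=
        lintegral_lintegral_swap hk.aemeasurable
    _ = ∫⁻ z, F z * ∫⁻ y in ball z s, Φ y ∂μ ∂μ := by
        refine lintegral_congr fun z => ?_
        rw [← lintegral_const_mul _ hΦ, ← lintegral_indicator measurableSet_ball]
        refine lintegral_congr fun y => ?_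
        by_cases hyz : dist y z < s
        · rw [indicator_of_mem (show y ∈ ball z s from hyz),
            indicator_of_mem (show (y, z) ∈ {p : X × X | dist p.2 p.1 < s} by
              rwa [mem_ofPred_eq, dist_comm]), mul_comm]
        · rw [indicator_of_notMem (show y ∉ ball z s from hyz),
            indicator_of_notMem (show (y, z) ∉ {p : X × X | dist p.2 p.1 < s} by
              rwa [mem_ofPred_eq, dist_comm]), mul_zero]

lemma MMS.lintegral_ball_le_of_density [BorelSpace X] (hX : MMS μ Cd CP lam) {y : X} {r : ℝ}
    (hr : 0 < r) {w : X → ℝ} (hw0 : ∀ z, 0 ≤ w z) (hw : Measurable w) (hwi : LocallyIntegrable w μ)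
    {g : X → ℝ≥0∞} (hg : Measurable g) (hug : IsUpperGradientOn g w univ)
    (hd : 2 * μ ({z | 0 < w z} ∩ ball y r) ≤ μ (ball y r)) :
    ∫⁻ z in ball y r, ENNReal.ofReal (w z) ∂μ ≤
      2 * ENNReal.ofReal (CP * r) * ∫⁻ z in ball y (lam * r), g z ∂μ := by
  have := hX.properSpace
  set B := ball y r
  set m := ⨍ z in B, w z ∂μ with hm
  have hBfin : μ B ≠ ⊤ := (hX.measure_ball_lt_top y r).ne
  have hB0 : μ B ≠ 0 := (hX.measure_ball_pos y hr).ne'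
  have hint : IntegrableOn w B μ :=
    (hwi.integrableOn_isCompact (isCompact_closedBall y r)).mono_set ball_subset_closedBall
  have hm0 : 0 ≤ m := by
    rw [hm, setAverage_eq]
    exact smul_nonneg (by positivity) (integral_nonneg fun z => hw0 z)
  have hmB : ENNReal.ofReal m * μ B = ∫⁻ z in B, ENNReal.ofReal (w z) ∂μ := by
    rw [← ofReal_integral_eq_lintegral_ofReal hint (ae_of_all _ fun z => hw0 z), hm, setAverage_eq,
      smul_eq_mul, ENNReal.ofReal_mul (by positivity), mul_right_comm]
    rw [measureReal_def, ENNReal.ofReal_inv_of_pos (ENNReal.toReal_pos hB0 hBfin),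
      ENNReal.ofReal_toReal hBfin, ENNReal.inv_mul_cancel hB0 hBfin, one_mul]
  have hZ : μ B ≤ 2 * μ (B ∩ {z | w z = 0}) := by
    have h1 : μ B ≤ μ ({z | 0 < w z} ∩ B) + μ (B ∩ {z | w z = 0}) := by
      refine (measure_mono fun z hz => ?_).trans (measure_union_le _ _)
      rcases (hw0 z).lt_or_eq with h | h
      · exact Or.inl ⟨h, hz⟩
      · exact Or.inr ⟨hz, h.symm⟩
    have h2 : μ B + μ B ≤ μ B + 2 * μ (B ∩ {z | w z = 0}) := by
      calc μ B + μ B = 2 * μ B := (two_mul _).symm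
        _ ≤ 2 * μ ({z | 0 < w z} ∩ B) + 2 * μ (B ∩ {z | w z = 0}) := by
          rw [← mul_add]; exact mul_le_mul_right h1 _
        _ ≤ _ := add_le_add_left hd _
    exact (ENNReal.add_le_add_iff_left hBfin).1 h2
  have hlow : ENNReal.ofReal m * μ (B ∩ {z | w z = 0}) ≤
      ∫⁻ z in B, ENNReal.ofReal |w z - m| ∂μ := by
    rw [← setLIntegral_const]
    have hms : MeasurableSet (B ∩ {z | w z = 0}) :=
      measurableSet_ball.inter (hw (measurableSet_singleton 0))
    calc ∫⁻ _ in B ∩ {z | w z = 0}, ENNReal.ofReal m ∂μ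
        ≤ ∫⁻ z in B ∩ {z | w z = 0}, ENNReal.ofReal |w z - m| ∂μ := by
          refine setLIntegral_mono' hms fun z hz => ?_
          have : w z = 0 := hz.2
          rw [this, zero_sub, abs_neg]
          exact ENNReal.ofReal_le_ofReal (le_abs_self m)
      _ ≤ _ := lintegral_mono_set inter_subset_left
  have hP := hX.poincare y r hr w hwi g hg hug
  have hratio : μ B / μ (ball y (lam * r)) ≤ 1 := by
    refine ENNReal.div_le_of_le_mul ?_
    rw [one_mul]
    exact measure_mono (ball_subset_ball (le_mul_of_one_le_left hr.le hX.hlam))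
  calc ∫⁻ z in B, ENNReal.ofReal (w z) ∂μ = ENNReal.ofReal m * μ B := hmB.symm
    _ ≤ ENNReal.ofReal m * (2 * μ (B ∩ {z | w z = 0})) := mul_le_mul_right hZ _
    _ = 2 * (ENNReal.ofReal m * μ (B ∩ {z | w z = 0})) := by ring
    _ ≤ 2 * (ENNReal.ofReal (CP * r) * 1 * ∫⁻ z in ball y (lam * r), g z ∂μ) := by
      refine mul_le_mul_right (hlow.trans (hP.trans ?_)) _
      gcongr
    _ = _ := by rw [mul_one, mul_assoc]

/-- The constant in the Sobolev inequality `MMS.lintegral_le_of_density`. -/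
def sobolevConst (Cd CP lam : ℝ) : ℝ≥0∞ :=
  ENNReal.ofReal Cd * (2 * ENNReal.ofReal CP * ENNReal.ofReal Cd ^ (⌈2 * lam⌉₊))

lemma MMS.lintegral_le_of_density [BorelSpace X] (hX : MMS μ Cd CP lam) {x : X} {ρ r : ℝ}
    (hr : 0 < r) {w : X → ℝ} (hw0 : ∀ z, 0 ≤ w z) (hw : Measurable w) (hwi : LocallyIntegrable w μ)
    {g : X → ℝ≥0∞} (hg : Measurable g) (hug : IsUpperGradientOn g w univ)
    (hd : ∀ y ∈ ball x (ρ + r), 2 * μ ({z | 0 < w z} ∩ ball y r) ≤ μ (ball y r)) :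
    ∫⁻ z in ball x ρ, ENNReal.ofReal (w z) ∂μ ≤
      sobolevConst Cd CP lam * ENNReal.ofReal r * ∫⁻ z in ball x (ρ + (1 + lam) * r), g z ∂μ := by
  have := hX.properSpace
  have := hX.isLocallyFiniteMeasure
  have hlam0 : 0 < lam := one_pos.trans_le hX.hlam
  set Φ : X → ℝ≥0∞ := fun y => (μ (ball y r))⁻¹ with hΦdef
  have hΦ : Measurable Φ := (measurable_measure_ball r).inv
  set F : X → ℝ≥0∞ := (ball x ρ).indicator fun z => ENNReal.ofReal (w z) with hFdef
  have hF : Measurable F := hw.ennreal_ofReal.indicator measurableSet_ball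
  set G : X → ℝ≥0∞ := (ball x (ρ + (1 + lam) * r)).indicator g with hGdef
  have hG : Measurable G := hg.indicator measurableSet_ball
  have hC1 : ∀ z, 1 ≤ ENNReal.ofReal Cd * ∫⁻ y in ball z r, Φ y ∂μ := by
    intro z
    have h0 := (hX.measure_ball_pos z hr).ne'
    have ht := (hX.measure_ball_lt_top z r).ne
    have hCd0 : ENNReal.ofReal Cd ≠ 0 := (ENNReal.ofReal_pos.2 (one_pos.trans_le hX.hCd)).ne'
    have hle : ∀ y ∈ ball z r, (ENNReal.ofReal Cd * μ (ball z r))⁻¹ ≤ Φ y := by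
      intro y hy
      refine ENNReal.inv_le_inv.2 ?_
      have := hX.measure_ball_le (x := y) (y := z) (R := r) hr (n := 1)
        (by rw [mem_ball] at hy; linarith)
      simpa using this
    calc (1 : ℝ≥0∞) = ENNReal.ofReal Cd * ((ENNReal.ofReal Cd * μ (ball z r))⁻¹ * μ (ball z r)) := by
          rw [ENNReal.mul_inv (Or.inl hCd0) (Or.inl ENNReal.ofReal_ne_top), mul_assoc,
            ENNReal.inv_mul_cancel h0 ht, mul_one,
            ENNReal.mul_inv_cancel hCd0 ENNReal.ofReal_ne_top]
      _ ≤ _ := by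
          rw [← setLIntegral_const]
          exact mul_le_mul_right (setLIntegral_mono' measurableSet_ball hle) _
  have hC2 : ∀ z, ∫⁻ y in ball z (lam * r), Φ y ∂μ ≤ ENNReal.ofReal Cd ^ (⌈2 * lam⌉₊) := by
    intro z
    have hlr : 0 < lam * r := by positivity
    have h0 := (hX.measure_ball_pos z hlr).ne'
    have ht := (hX.measure_ball_lt_top z (lam * r)).ne
    have hle : ∀ y ∈ ball z (lam * r),
        Φ y ≤ ENNReal.ofReal Cd ^ (⌈2 * lam⌉₊) * (μ (ball z (lam * r)))⁻¹ := by
      intro y hy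
      have h1 : (2 * lam) ≤ 2 ^ (⌈2 * lam⌉₊) :=
        (Nat.le_ceil _).trans (by exact_mod_cast (Nat.lt_two_pow_self).le)
      have := hX.measure_ball_le (x := z) (y := y) (R := lam * r) hr (n := ⌈2 * lam⌉₊) (by
        rw [mem_ball, dist_comm] at hy
        have := mul_le_mul_of_nonneg_right h1 hr.le
        linarith)
      rw [← div_eq_mul_inv, ENNReal.le_div_iff_mul_le (Or.inl h0) (Or.inl ht), mul_comm,
        ← div_eq_mul_inv]
      exact ENNReal.div_le_of_le_mul this
    refine (setLIntegral_mono' measurableSet_ball hle).trans ?_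
    rw [setLIntegral_const, mul_assoc, ENNReal.inv_mul_cancel h0 ht, mul_one]
  have hball : ∀ y, ∫⁻ z in ball y r, F z ∂μ ≤
      2 * ENNReal.ofReal (CP * r) * ∫⁻ z in ball y (lam * r), G z ∂μ := by
    intro y
    by_cases hy : y ∈ ball x (ρ + r)
    · calc ∫⁻ z in ball y r, F z ∂μ ≤ ∫⁻ z in ball y r, ENNReal.ofReal (w z) ∂μ :=
            lintegral_mono fun z => indicator_le_self _ _ z
        _ ≤ 2 * ENNReal.ofReal (CP * r) * ∫⁻ z in ball y (lam * r), g z ∂μ :=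
            hX.lintegral_ball_le_of_density hr hw0 hw hwi hg hug (hd y hy)
        _ = _ := by
            congr 1
            refine setLIntegral_congr_fun measurableSet_ball fun z hz => ?_
            rw [hGdef, indicator_of_mem]
            rw [mem_ball] at hz hy ⊢
            linarith [dist_triangle z y x]
    · have : ∫⁻ z in ball y r, F z ∂μ = ∫⁻ z in ball y r, 0 ∂μ := by
        refine setLIntegral_congr_fun measurableSet_ball fun z hz => ?_
        rw [hFdef, indicator_of_notMem]
        intro hzx
        rw [mem_ball] at hz hzx
        refine hy ?_
        rw [mem_ball]
        linarith [dist_triangle y z x, dist_comm y z]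
      rw [this]; simp
  calc ∫⁻ z in ball x ρ, ENNReal.ofReal (w z) ∂μ = ∫⁻ z, F z ∂μ :=
        (lintegral_indicator measurableSet_ball _).symm
    _ ≤ ∫⁻ z, ENNReal.ofReal Cd * (F z * ∫⁻ y in ball z r, Φ y ∂μ) ∂μ := by
        refine lintegral_mono fun z => ?_
        rw [mul_left_comm]
        exact le_mul_of_one_le_right' (hC1 z)
    _ = ENNReal.ofReal Cd * ∫⁻ y, Φ y * ∫⁻ z in ball y r, F z ∂μ ∂μ := by
        rw [lintegral_const_mul' _ _ ENNReal.ofReal_ne_top,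
          lintegral_mul_lintegral_ball_comm hΦ hF]
    _ ≤ ENNReal.ofReal Cd * ∫⁻ y, (2 * ENNReal.ofReal (CP * r)) *
          (Φ y * ∫⁻ z in ball y (lam * r), G z ∂μ) ∂μ := by
        refine mul_le_mul_right (lintegral_mono fun y => ?_) _
        rw [mul_left_comm]
        exact mul_le_mul_right (hball y) _
    _ = ENNReal.ofReal Cd * ((2 * ENNReal.ofReal (CP * r)) *
          ∫⁻ z, G z * ∫⁻ y in ball z (lam * r), Φ y ∂μ ∂μ) := by
        rw [lintegral_const_mul' _ _ (by finiteness), lintegral_mul_lintegral_ball_comm hΦ hG]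
    _ ≤ ENNReal.ofReal Cd * ((2 * ENNReal.ofReal (CP * r)) *
          ∫⁻ z, G z * ENNReal.ofReal Cd ^ (⌈2 * lam⌉₊) ∂μ) := by
        gcongr with z
        exact hC2 z
    _ = _ := by
        rw [lintegral_mul_const _ hG, hGdef, lintegral_indicator measurableSet_ball,
          ENNReal.ofReal_mul hX.hCP.le, sobolevConst]
        ring

end Sobolev

section Cutoff

omit [MeasurableSpace X] in
lemma LocLipschitzOn.min_const {u : X → ℝ} {U : Set X} (hu : LocLipschitzOn u U) (k : ℝ) :
    LocLipschitzOn (fun x => min (u x) k) U := by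
  intro K hK hKU
  obtain ⟨L, hL⟩ := hu K hK hKU
  refine ⟨L, LipschitzOnWith.of_dist_le_mul fun p hp q hq => ?_⟩
  exact (abs_min_sub_min_le_max _ _ _ _).trans
    (max_le (hL.dist_le_mul p hp q hq) (by rw [sub_self, abs_zero]; positivity))

omit [MeasurableSpace X] in
lemma LocLipschitzOn.continuous [ProperSpace X] {u : X → ℝ} (hu : LocLipschitzOn u univ) :
    Continuous u := by
  refine continuous_iff_continuousAt.2 fun x => ?_
  obtain ⟨L, hL⟩ := hu _ (isCompact_closedBall x 1) (subset_univ _)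
  exact hL.continuousOn.continuousAt (closedBall_mem_nhds x one_pos)

omit [MeasurableSpace X] in
lemma LocLipschitzOn.glue {a b η : X → ℝ} {L : ℝ≥0} {U : Set X} (ha : LocLipschitzOn a U)
    (hb : LocLipschitzOn b univ) (hηL : LipschitzWith L η) (hη0 : ∀ z, 0 ≤ η z)
    (hη1 : ∀ z, η z ≤ 1) (hηU : tsupport η ⊆ U) :
    LocLipschitzOn (fun z => η z * a z + (1 - η z) * b z) univ :=
  (ha.cutoff_mul hηL hη0 hη1 hηU).add
    (hb.cutoff_mul (η := fun z => 1 - η z) (L := L)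
      (LipschitzWith.of_dist_le_mul fun p q => by
        rw [Real.dist_eq, show 1 - η p - (1 - η q) = η q - η p by ring, ← Real.dist_eq, dist_comm p]
        exact hηL.dist_le_mul q p)
      (fun z => sub_nonneg.2 (hη1 z)) (fun z => sub_le_self _ (hη0 z)) (subset_univ _))

omit [MeasurableSpace X] in
lemma exists_cutoff (K : Set X) {a b : ℝ} (hab : a < b) :
    ∃ η : X → ℝ, LipschitzWith (Real.toNNReal (1 / (b - a))) η ∧ (∀ z, 0 ≤ η z) ∧
      (∀ z, η z ≤ 1) ∧ (∀ z, infDist z K ≤ a → η z = 1) ∧ (∀ z, b ≤ infDist z K → η z = 0) ∧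
      (∀ z ∉ {z | a ≤ infDist z K ∧ infDist z K ≤ b}, ∀ᶠ y in 𝓝 z, η y = η z) ∧
      tsupport η ⊆ {z | infDist z K ≤ b} := by
  have hba : 0 < b - a := sub_pos.2 hab
  set η : X → ℝ := fun z => max 0 (min 1 ((b - infDist z K) / (b - a))) with hη
  have h1 : ∀ z, infDist z K ≤ a → η z = 1 := by
    intro z hz
    have : 1 ≤ (b - infDist z K) / (b - a) := by rw [le_div_iff₀ hba]; linarith
    simp [hη, this]
  have h0 : ∀ z, b ≤ infDist z K → η z = 0 := by
    intro z hz
    have : (b - infDist z K) / (b - a) ≤ 0 := div_nonpos_of_nonpos_of_nonneg (by linarith) hba.le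
    simp [hη, this]
  have hc : Continuous fun z => infDist z K := continuous_infDist_pt K
  refine ⟨η, LipschitzWith.of_dist_le_mul fun p q => ?_, fun z => le_max_left _ _,
    fun z => max_le zero_le_one (min_le_left _ _), h1, h0, fun z hz => ?_, ?_⟩
  · rw [Real.coe_toNNReal _ (by positivity), Real.dist_eq]
    calc |η p - η q| ≤ |(b - infDist p K) / (b - a) - (b - infDist q K) / (b - a)| := by
          refine (abs_max_sub_max_le_max _ _ _ _).trans (max_le (by simp) ?_)
          refine (abs_min_sub_min_le_max _ _ _ _).trans (max_le (by simp) le_rfl)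
      _ = 1 / (b - a) * |infDist q K - infDist p K| := by
          rw [← sub_div, abs_div, abs_of_pos hba, div_eq_inv_mul, one_div]
          congr 2; ring
      _ ≤ 1 / (b - a) * dist p q := by
          gcongr
          rw [← Real.dist_eq, dist_comm p]
          have := (lipschitz_infDist_pt K).dist_le_mul q p
          simpa using this
  · rw [mem_ofPred_eq, not_and_or, not_le, not_le] at hz
    rcases hz with hz | hz
    · filter_upwards [hc.continuousAt.eventually_lt_const hz] with y hy
      rw [h1 y hy.le, h1 z hz.le]
    · filter_upwards [hc.continuousAt.eventually_const_lt hz] with y hy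
      rw [h0 y hy.le, h0 z hz.le]
  · refine closure_minimal (fun z hz => ?_) (isClosed_le hc continuous_const)
    by_contra hlt
    exact hz (h0 z (not_le.1 hlt).le)

lemma TendstoL1Loc.mono_fun {μ : Measure X} {v v' : ℕ → X → ℝ} {u u' : X → ℝ} {U : Set X}
    (h : TendstoL1Loc μ v u U) (hle : ∀ i z, |v' i z - u' z| ≤ |v i z - u z|) :
    TendstoL1Loc μ v' u' U := fun K hK hKU =>
  tendsto_of_tendsto_of_tendsto_of_le_of_le tendsto_const_nhds (h K hK hKU) (fun _ => zero_le)
    fun i => lintegral_mono fun z => ENNReal.ofReal_le_ofReal (hle i z)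

end Cutoff

section Caccioppoli

variable {μ : Measure X}

lemma exists_approx [BorelSpace X] {u : X → ℝ} {U : Set X} (hT : tv μ u U ≠ ⊤) {ε : ℝ≥0∞}
    (hε : ε ≠ 0) :
    ∃ (v : ℕ → X → ℝ) (g : ℕ → X → ℝ≥0∞), (∀ i, LocLipschitzOn (v i) U) ∧ TendstoL1Loc μ v u U ∧
      (∀ i, Measurable (g i)) ∧ (∀ i, IsUpperGradientOn (g i) (v i) U) ∧
      ∀ i, ∫⁻ x in U, g i x ∂μ ≤ tv μ u U + ε := by
  have hε2 : ε / 2 ≠ 0 := by simpa using hε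
  have hlt : tv μ u U < tv μ u U + ε / 2 := ENNReal.lt_add_right hT hε2
  nth_rw 1 [tv] at hlt
  simp only [iInf_lt_iff] at hlt
  obtain ⟨v, hv, hvu, g, hg, hgv, hlt⟩ := hlt
  obtain ⟨φ, hφ, hφlt⟩ := extraction_of_frequently_atTop (frequently_lt_of_liminf_lt (by isBoundedDefault) hlt)
  choose σ hσm hσ hσu using fun i => (hgv i).exists_isUpperGradientOn hε2
  refine ⟨fun i => v (φ i), fun i x => g (φ i) x + σ (φ i) x, fun i => hv _,
    fun K hK hKU => (hvu K hK hKU).comp hφ.tendsto_atTop, fun i => (hg _).add (hσm _),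
    fun i => hσu _, fun i => ?_⟩
  rw [lintegral_add_left (hg _)]
  calc _ ≤ (tv μ u U + ε / 2) + ε / 2 :=
        add_le_add (hφlt i).le ((setLIntegral_le_lintegral _ _).trans (hσ _))
    _ = _ := by rw [add_assoc, ENNReal.add_halves]

lemma tv_le_liminf {u : X → ℝ} {U : Set X} {v : ℕ → X → ℝ} {g : ℕ → X → ℝ≥0∞}
    (hv : ∀ i, LocLipschitzOn (v i) U) (hvu : TendstoL1Loc μ v u U) (hg : ∀ i, Measurable (g i))
    (hgv : ∀ i, IsWeakUpperGradientOn μ (g i) (v i) U) :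
    tv μ u U ≤ liminf (fun i => ∫⁻ x in U, g i x ∂μ) atTop :=
  iInf_le_of_le v <| iInf_le_of_le hv <| iInf_le_of_le hvu <| iInf_le_of_le g <|
    iInf_le_of_le hg <| iInf_le _ hgv

/-- Caccioppoli inequality for approximations of a function that does not gain total variation
by truncation from above. -/
lemma exists_caccioppoli_approx [BorelSpace X] [ProperSpace X] {u : X → ℝ}
    (hT : tv μ u univ ≠ ⊤) {k : ℝ} {η : X → ℝ} {L : ℝ≥0} {S : Set X} (hηL : LipschitzWith L η)
    (hη0 : ∀ z, 0 ≤ η z) (hη1 : ∀ z, η z ≤ 1) (hS : ∀ z ∉ S, ∀ᶠ y in 𝓝 z, η y = η z)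
    (hSm : MeasurableSet S)
    (hmin : tv μ u univ ≤ tv μ (fun z => η z * min (u z) k + (1 - η z) * u z) univ)
    {ε : ℝ≥0∞} (hε : ε ≠ 0) (hεt : ε ≠ ⊤) :
    ∃ (v : ℕ → X → ℝ) (g : ℕ → X → ℝ≥0∞), (∀ i, LocLipschitzOn (v i) univ) ∧
      TendstoL1Loc μ v u univ ∧ (∀ i, Measurable (g i)) ∧
      (∀ i, IsUpperGradientOn (g i) (v i) univ) ∧ (∀ i, ∫⁻ z, g i z ∂μ ≠ ⊤) ∧
      ∀ᶠ i in atTop, ∫⁻ z, ENNReal.ofReal (η z) * {z | k < v i z}.indicator (g i) z ∂μ ≤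
        ε + L * ∫⁻ z in S, ENNReal.ofReal (v i z - k) ∂μ := by
  set δ := ε / 3 with hδ
  have hδ0 : δ ≠ 0 := by simpa [hδ] using hε
  obtain ⟨v, g, hv, hvu, hg, hgv, hgT⟩ := exists_approx hT hδ0
  simp only [setLIntegral_univ] at hgT
  have hδt : δ ≠ ⊤ := (ENNReal.div_lt_top hεt (by norm_num)).ne
  have hfin : ∀ i, ∫⁻ z, g i z ∂μ ≠ ⊤ := fun i =>
    ((hgT i).trans_lt (ENNReal.add_lt_top.2 ⟨hT.lt_top, hδt.lt_top⟩)).ne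
  have hvm : ∀ i, Measurable (v i) := fun i => (hv i).continuous.measurable
  have hηm : Measurable η := hηL.continuous.measurable
  choose σ hσm hσ hσu using fun i =>
    ((hgv i).min_const (hv i) (hg i) (hfin i) k).exists_isUpperGradientOn hδ0
  set a : ℕ → X → ℝ := fun i z => min (v i z) k with ha
  set ga : ℕ → X → ℝ≥0∞ := fun i z => {x | v i x < k}.indicator (g i) z + σ i z with hga
  have hlt : ∀ i, MeasurableSet {x | v i x < k} := fun i =>
    measurableSet_lt (hvm i) measurable_const
  have hgam : ∀ i, Measurable (ga i) := fun i => ((hg i).indicator (hlt i)).add (hσm i)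
  have hgafin : ∀ i, ∫⁻ z, ga i z ∂μ ≠ ⊤ := by
    intro i
    rw [hga, lintegral_add_left ((hg i).indicator (hlt i))]
    refine ENNReal.add_ne_top.2 ⟨?_, ((hσ i).trans_lt hδt.lt_top).ne⟩
    exact ((lintegral_mono (indicator_le_self _ _)).trans_lt (hfin i).lt_top).ne
  have hloc : ∀ i, LocLipschitzOn (fun z => η z * a i z + (1 - η z) * v i z) univ := fun i =>
    ((hv i).min_const k).glue (hv i) hηL hη0 hη1 (subset_univ _)
  have hglue : ∀ i, IsWeakUpperGradientOn μ (glueGrad η (a i) (v i) L S (ga i) (g i))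
      (fun z => η z * a i z + (1 - η z) * v i z) univ := fun i =>
    isWeakUpperGradientOn_glue isOpen_univ hηL hη0 hη1 hS (subset_univ _) (hσu i) (hgv i)
      (hgam i) (hg i) (hgafin i) (hfin i) (hloc i)
  have hm1 : ∀ i, Measurable fun z => ENNReal.ofReal (η z) * ga i z := fun i =>
    hηm.ennreal_ofReal.mul (hgam i)
  have hm2 : ∀ i, Measurable fun z => ENNReal.ofReal (1 - η z) * g i z := fun i =>
    (measurable_const.sub hηm).ennreal_ofReal.mul (hg i)
  have hm3 : ∀ i, Measurable (S.indicator fun z => ENNReal.ofReal (|a i z - v i z| * L)) :=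
    fun i => ((((hvm i).min measurable_const).sub (hvm i)).norm.mul_const _).ennreal_ofReal.indicator
      hSm
  have hconv : TendstoL1Loc μ (fun i z => η z * a i z + (1 - η z) * v i z)
      (fun z => η z * min (u z) k + (1 - η z) * u z) univ := by
    refine hvu.mono_fun fun i z => ?_
    have h1 : |min (v i z) k - min (u z) k| ≤ |v i z - u z| :=
      (abs_min_sub_min_le_max _ _ _ _).trans (max_le le_rfl (by simp))
    calc |η z * a i z + (1 - η z) * v i z - (η z * min (u z) k + (1 - η z) * u z)|
        = |η z * (min (v i z) k - min (u z) k) + (1 - η z) * (v i z - u z)| := by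
          congr 1; ring
      _ ≤ η z * |v i z - u z| + (1 - η z) * |v i z - u z| := by
          refine (abs_add_le _ _).trans ?_
          rw [abs_mul, abs_mul, abs_of_nonneg (hη0 z), abs_of_nonneg (sub_nonneg.2 (hη1 z))]
          gcongr
          exact hη0 z
      _ = _ := by ring
  have hlim := hmin.trans (tv_le_liminf hloc hconv
    (fun i => ((hm1 i).add (hm2 i)).add (hm3 i)) hglue)
  simp only [setLIntegral_univ] at hlim
  have hev : ∀ᶠ i in atTop, tv μ u univ ≤
      ∫⁻ z, glueGrad η (a i) (v i) L S (ga i) (g i) z ∂μ + δ := by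
    rcases eq_or_ne (tv μ u univ) 0 with h0 | h0
    · rw [h0]; exact Eventually.of_forall fun _ => zero_le
    · filter_upwards [eventually_lt_of_lt_liminf ((ENNReal.sub_lt_self hT h0 hδ0).trans_le hlim)]
        with i hi
      exact tsub_le_iff_right.1 hi.le
  refine ⟨v, g, hv, hvu, hg, hgv, hfin, ?_⟩
  filter_upwards [hev] with i hi
  set P := ∫⁻ z, ENNReal.ofReal (η z) * {z | v i z < k}.indicator (g i) z ∂μ with hP
  set Q := ∫⁻ z, ENNReal.ofReal (1 - η z) * g i z ∂μ with hQ
  set A := ∫⁻ z, ENNReal.ofReal (η z) * {z | k < v i z}.indicator (g i) z ∂μ with hA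
  set W := ∫⁻ z in S, ENNReal.ofReal (v i z - k) ∂μ with hW
  have hmP : Measurable fun z => ENNReal.ofReal (η z) * {z | v i z < k}.indicator (g i) z :=
    hηm.ennreal_ofReal.mul ((hg i).indicator (hlt i))
  have hmA : Measurable fun z => ENNReal.ofReal (η z) * {z | k < v i z}.indicator (g i) z :=
    hηm.ennreal_ofReal.mul ((hg i).indicator (measurableSet_lt measurable_const (hvm i)))
  have hsplit : A + (P + Q) ≤ ∫⁻ z, g i z ∂μ := by
    rw [hA, hP, hQ, ← lintegral_add_left hmP, ← lintegral_add_left hmA]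
    refine lintegral_mono fun z => ?_
    have h1 : ENNReal.ofReal (η z) + ENNReal.ofReal (1 - η z) = 1 := by
      rw [← ENNReal.ofReal_add (hη0 z) (sub_nonneg.2 (hη1 z))]; simp
    calc _ ≤ ENNReal.ofReal (η z) * g i z + ENNReal.ofReal (1 - η z) * g i z := by
          rw [← add_assoc, ← mul_add]
          gcongr
          rcases lt_trichotomy (v i z) k with h | h | h
          · simp [h, h.not_gt]
          · simp [h]
          · simp [h, h.not_gt]
      _ = g i z := by rw [← add_mul, h1, one_mul]
  have hG : ∫⁻ z, glueGrad η (a i) (v i) L S (ga i) (g i) z ∂μ ≤ P + δ + Q + L * W := by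
    simp only [glueGrad]
    have hm12 : Measurable fun z => ENNReal.ofReal (η z) * ga i z +
        ENNReal.ofReal (1 - η z) * g i z := (hm1 i).add (hm2 i)
    rw [lintegral_add_left hm12, lintegral_add_left (hm1 i)]
    refine add_le_add (add_le_add ?_ le_rfl) ?_
    · simp only [hga, mul_add]
      rw [lintegral_add_left hmP]
      refine add_le_add le_rfl ((lintegral_mono fun z => ?_).trans (hσ i))
      exact mul_le_of_le_one_left' (ENNReal.ofReal_le_one.2 (hη1 z))
    · rw [lintegral_indicator hSm, hW, ← lintegral_const_mul' _ _ ENNReal.coe_ne_top]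
      refine lintegral_mono fun z => ?_
      rw [ENNReal.ofReal_mul' L.coe_nonneg, ENNReal.ofReal_coe_nnreal, mul_comm]
      refine mul_le_mul_right ?_ _
      rcases le_total (v i z) k with h | h
      · simp [ha, h]
      · simp only [ha]
        rw [min_eq_right h, abs_sub_comm, abs_of_nonneg (sub_nonneg.2 h)]
  have hPQ : P + Q ≠ ⊤ := ne_top_of_le_ne_top (hfin i) (le_add_self.trans hsplit)
  have hfinal : P + Q + A ≤ P + Q + (ε + L * W) := by
    calc P + Q + A = A + (P + Q) := add_comm _ _
      _ ≤ tv μ u univ + δ := hsplit.trans (hgT i)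
      _ ≤ (P + δ + Q + L * W + δ) + δ := by gcongr; exact hi.trans (by gcongr)
      _ = P + Q + ((δ + δ + δ) + L * W) := by ring
      _ = _ := by rw [hδ, ENNReal.add_thirds]
  exact (ENNReal.add_le_add_iff_left hPQ).1 hfinal

end Caccioppoli

section DeGiorgi

variable {μ : Measure X} {Cd CP lam : ℝ}

/-- Truncating `u` from above at level `k` inside `closedBall x R` does not decrease the total
variation. -/
def TruncMin (μ : Measure X) (u : X → ℝ) (k : ℝ) (x : X) (R : ℝ) : Prop :=
  ∀ (η : X → ℝ) (L : ℝ≥0), LipschitzWith L η → (∀ z, 0 ≤ η z) → (∀ z, η z ≤ 1) →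
    tsupport η ⊆ closedBall x R →
    tv μ u univ ≤ tv μ (fun z => η z * min (u z) k + (1 - η z) * u z) univ

lemma TruncMin.mono {u : X → ℝ} {k : ℝ} {x : X} {R R' : ℝ} (h : TruncMin μ u k x R)
    (hR : R' ≤ R) : TruncMin μ u k x R' := fun η L hL h0 h1 hs =>
  h η L hL h0 h1 (hs.trans (closedBall_subset_closedBall hR))

omit [MetricSpace X] in
lemma lintegral_excess_le {u v : X → ℝ} {ν : Measure X} (hv : AEMeasurable v ν) (k : ℝ) :
    ∫⁻ z, ENNReal.ofReal (u z - k) ∂ν ≤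
      ∫⁻ z, ENNReal.ofReal (v z - k) ∂ν + ∫⁻ z, ENNReal.ofReal |v z - u z| ∂ν := by
  rw [← lintegral_add_left' (hv.sub_const k).ennreal_ofReal]
  refine lintegral_mono fun z => ?_
  rw [abs_sub_comm]
  refine (ENNReal.ofReal_le_ofReal ?_).trans ENNReal.ofReal_add_le
  linarith [le_abs_self (u z - v z)]

lemma MMS.excess_step [BorelSpace X] (hX : MMS μ Cd CP lam) {u : X → ℝ}
    (hu : LocallyIntegrable u μ) (hT : tv μ u univ ≠ ⊤) {x : X} {ρ ρ' r k k' : ℝ} {m : ℝ≥0∞}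
    (hρ : ρ < ρ') (hr : 0 < r) (hrρ : 2 * (1 + lam) * r ≤ ρ' - ρ) (hk : k' < k)
    (hmin : TruncMin μ u k x ρ') (hm : ∀ y ∈ ball x (ρ + r), m ≤ μ (ball y r))
    (hex : 2 * ∫⁻ z in ball x ρ', ENNReal.ofReal (u z - k') ∂μ < m * ENNReal.ofReal (k - k')) :
    ∫⁻ z in ball x ρ, ENNReal.ofReal (u z - k) ∂μ ≤
      sobolevConst Cd CP lam * ENNReal.ofReal r * (ENNReal.ofReal (4 / (ρ' - ρ)) *
        ∫⁻ z in ball x ρ', ENNReal.ofReal (u z - k) ∂μ) := by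
  have := hX.properSpace
  have := hX.isLocallyFiniteMeasure
  have hum : AEMeasurable u μ := hu.aestronglyMeasurable.aemeasurable
  have hlam := hX.hlam
  set a := (ρ + ρ') / 2 with ha
  set b := (ρ + 3 * ρ') / 4 with hb
  have hab : a < b := by rw [ha, hb]; linarith
  have hbρ : b < ρ' := by rw [hb]; linarith
  obtain ⟨η, hηL, hη0, hη1, hone, -, hS, hsupp⟩ := exists_cutoff {x} hab
  simp only [infDist_singleton] at hone hS hsupp
  have hba : 1 / (b - a) = 4 / (ρ' - ρ) := by
    rw [show b - a = (ρ' - ρ) / 4 by rw [ha, hb]; ring, one_div_div]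
  set L := Real.toNNReal (1 / (b - a)) with hL
  set S := {z | a ≤ dist z x ∧ dist z x ≤ b} with hSdef
  have hSm : MeasurableSet S :=
    ((isClosed_le continuous_const (continuous_id.dist continuous_const)).inter
      (isClosed_le (continuous_id.dist continuous_const) continuous_const)).measurableSet
  have hSsub : S ⊆ ball x ρ' := fun z hz => hz.2.trans_lt hbρ
  set C := sobolevConst Cd CP lam with hC
  have hCt : C ≠ ⊤ := by rw [hC, sobolevConst]; finiteness
  set I := ∫⁻ z in ball x ρ', ENNReal.ofReal (u z - k) ∂μ with hI
  have key : ∀ ε : ℝ≥0∞, ε ≠ 0 → ε ≠ ⊤ → ∫⁻ z in ball x ρ, ENNReal.ofReal (u z - k) ∂μ ≤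
      C * ENNReal.ofReal r * (2 * ε + L * I) := by
    intro ε hε hεt
    obtain ⟨v, g, hv, hvu, hg, hgv, hfin, hcac⟩ := exists_caccioppoli_approx hT hηL hη0 hη1 hS hSm
      (hmin η L hηL hη0 hη1 (hsupp.trans fun z hz => le_trans hz hbρ.le)) hε hεt
    have hvm : ∀ i, Measurable (v i) := fun i => (hv i).continuous.measurable
    set δ : ℕ → ℝ≥0∞ := fun i => ∫⁻ z in closedBall x ρ', ENNReal.ofReal |v i z - u z| ∂μ with hδ
    have hδ0 : Tendsto δ atTop (𝓝 0) := hvu _ (isCompact_closedBall x ρ') (subset_univ _)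
    have hδle : ∀ i, ∀ A ⊆ ball x ρ', ∫⁻ z in A, ENNReal.ofReal |v i z - u z| ∂μ ≤ δ i :=
      fun i A hA => lintegral_mono_set (hA.trans ball_subset_closedBall)
    have hup : ∀ i κ, ∀ A ⊆ ball x ρ', ∫⁻ z in A, ENNReal.ofReal (v i z - κ) ∂μ ≤
        ∫⁻ z in A, ENNReal.ofReal (u z - κ) ∂μ + δ i := by
      intro i κ A hA
      refine (lintegral_excess_le hum.restrict κ).trans (add_le_add le_rfl ?_)
      simp only [abs_sub_comm (u _)]
      exact hδle i A hA
    have hdens : ∀ᶠ i in atTop, 2 * (∫⁻ z in ball x ρ', ENNReal.ofReal (u z - k') ∂μ + δ i) <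
        m * ENNReal.ofReal (k - k') := by
      have : Tendsto (fun i => 2 * (∫⁻ z in ball x ρ', ENNReal.ofReal (u z - k') ∂μ + δ i)) atTop
          (𝓝 (2 * (∫⁻ z in ball x ρ', ENNReal.ofReal (u z - k') ∂μ + 0))) :=
        ENNReal.Tendsto.const_mul (tendsto_const_nhds.add hδ0) (Or.inr (by norm_num))
      rw [add_zero] at this
      exact this.eventually_lt_const hex
    have hbound : ∀ᶠ i in atTop, ∫⁻ z in ball x ρ, ENNReal.ofReal (u z - k) ∂μ ≤
        C * ENNReal.ofReal r * (2 * ε + L * (I + δ i)) + δ i := by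
      filter_upwards [hdens, hcac] with i hi hci
      set w : X → ℝ := fun z => max (v i z) k - k with hw
      have hw0 : ∀ z, 0 ≤ w z := fun z => sub_nonneg.2 (le_max_right _ _)
      have hwc : Continuous w := ((hv i).continuous.max continuous_const).sub continuous_const
      obtain ⟨σ, hσm, hσ, hσu⟩ :=
        ((hgv i).max_const (hv i) (hg i) (hfin i) k).exists_isUpperGradientOn hε
      have hum : MeasurableSet {z | k < v i z} := measurableSet_lt measurable_const (hvm i)
      have hwu : IsUpperGradientOn (fun z => {z | k < v i z}.indicator (g i) z + σ z) w univ := by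
        intro γ hγ
        have := hσu γ hγ
        simpa [hw] using this
      have hwpos : ∀ z, 0 < w z ↔ k < v i z := fun z => by simp [hw]
      have hcheb : 2 * μ ({z | 0 < w z} ∩ ball x ρ') ≤ m := by
        have h1 : ENNReal.ofReal (k - k') * μ ({z | 0 < w z} ∩ ball x ρ') ≤
            ∫⁻ z in ball x ρ', ENNReal.ofReal (v i z - k') ∂μ := by
          refine le_trans ?_ (mul_meas_ge_le_lintegral
            ((hvm i).sub_const k').ennreal_ofReal (ENNReal.ofReal (k - k')))
          refine mul_le_mul_right ((measure_mono ?_).trans (Measure.le_restrict_apply _ _)) _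
          rintro z ⟨hz, hzb⟩
          refine ⟨ENNReal.ofReal_le_ofReal ?_, hzb⟩
          have := (hwpos z).1 hz
          linarith
        have h2 : 2 * μ ({z | 0 < w z} ∩ ball x ρ') * ENNReal.ofReal (k - k') ≤
            m * ENNReal.ofReal (k - k') := by
          calc _ = 2 * (ENNReal.ofReal (k - k') * μ ({z | 0 < w z} ∩ ball x ρ')) := by ring
            _ ≤ _ := (mul_le_mul_right (h1.trans (hup i k' _ subset_rfl)) _).trans hi.le
        exact (ENNReal.mul_le_mul_iff_left (ENNReal.ofReal_pos.2 (sub_pos.2 hk)).ne'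
          ENNReal.ofReal_ne_top).1 h2
      have hsob := hX.lintegral_le_of_density (x := x) (ρ := ρ) hr hw0 hwc.measurable
        hwc.locallyIntegrable (((hg i).indicator hum).add hσm) hwu (fun y hy => by
          refine le_trans (mul_le_mul_right (measure_mono ?_) _) (hcheb.trans (hm y hy))
          refine inter_subset_inter_right _ (ball_subset_ball' ?_)
          rw [mem_ball] at hy
          nlinarith)
      have hgrad : ∫⁻ z in ball x (ρ + (1 + lam) * r),
          ({z | k < v i z}.indicator (g i) z + σ z) ∂μ ≤ 2 * ε + L * (I + δ i) := by
        rw [lintegral_add_left ((hg i).indicator hum), two_mul, add_comm ε ε, add_assoc, add_comm]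
        refine add_le_add ((setLIntegral_le_lintegral _ _).trans hσ) ?_
        calc ∫⁻ z in ball x (ρ + (1 + lam) * r), {z | k < v i z}.indicator (g i) z ∂μ
            ≤ ∫⁻ z in ball x (ρ + (1 + lam) * r),
                ENNReal.ofReal (η z) * {z | k < v i z}.indicator (g i) z ∂μ := by
              refine setLIntegral_mono' measurableSet_ball fun z hz => ?_
              rw [mem_ball] at hz
              rw [hone z (by rw [ha]; linarith), ENNReal.ofReal_one, one_mul]
          _ ≤ _ := (setLIntegral_le_lintegral _ _).trans hci
          _ ≤ _ := by
              gcongr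
              exact (hup i k S hSsub).trans (add_le_add (lintegral_mono_set hSsub) le_rfl)
      calc ∫⁻ z in ball x ρ, ENNReal.ofReal (u z - k) ∂μ
          ≤ ∫⁻ z in ball x ρ, ENNReal.ofReal (v i z - k) ∂μ + δ i :=
            (lintegral_excess_le (hvm i).aemeasurable k).trans
              (add_le_add le_rfl (hδle i _ (ball_subset_ball hρ.le)))
        _ ≤ ∫⁻ z in ball x ρ, ENNReal.ofReal (w z) ∂μ + δ i := by
            gcongr with z
            exact sub_le_sub_right (le_max_left _ _) _
        _ ≤ _ := add_le_add (hsob.trans (mul_le_mul_right hgrad _)) le_rfl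
    have : Tendsto (fun i => C * ENNReal.ofReal r * (2 * ε + L * (I + δ i)) + δ i) atTop
        (𝓝 (C * ENNReal.ofReal r * (2 * ε + L * (I + 0)) + 0)) := by
      refine Tendsto.add (ENNReal.Tendsto.const_mul (tendsto_const_nhds.add
        (ENNReal.Tendsto.const_mul (tendsto_const_nhds.add hδ0) (Or.inr ENNReal.coe_ne_top)))
        (Or.inr (by finiteness))) hδ0
    rw [add_zero, add_zero] at this
    exact ge_of_tendsto this hbound
  have hlim : Tendsto (fun ε : ℝ≥0∞ => C * ENNReal.ofReal r * (2 * ε + L * I)) (𝓝[>] 0)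
      (𝓝 (C * ENNReal.ofReal r * (2 * 0 + L * I))) := by
    refine (ENNReal.Tendsto.const_mul (Tendsto.add (ENNReal.Tendsto.const_mul tendsto_id
      (Or.inr (by norm_num))) tendsto_const_nhds) (Or.inr (by finiteness))).mono_left
      nhdsWithin_le_nhds
  rw [mul_zero, zero_add] at hlim
  have hfinal := ge_of_tendsto hlim (by
    filter_upwards [self_mem_nhdsWithin, nhdsWithin_le_nhds (Iio_mem_nhds ENNReal.zero_lt_top)]
      with ε h1 h2
    exact key ε (ne_of_gt h1) (ne_of_lt h2))
  rw [← hba]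
  exact hfinal

end DeGiorgi

section LocalBound

variable {μ : Measure X} {Cd CP lam : ℝ}

lemma MMS.exists_local_bound [BorelSpace X] (hX : MMS μ Cd CP lam) :
    ∃ σ : ℝ, 0 < σ ∧ ∀ (u : X → ℝ), LocallyIntegrable u μ → tv μ u univ ≠ ⊤ →
      ∀ (x : X) (R k d : ℝ), 0 < R → 0 < d → (∀ k' ≥ k, TruncMin μ u k' x R) →
      ∫⁻ z in ball x R, ENNReal.ofReal (u z - k) ∂μ ≤ ENNReal.ofReal (σ * d) * μ (ball x R) →
      ∀ᵐ z ∂μ.restrict (ball x (R / 2)), u z ≤ k + d := by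
  have hCd0 : 0 < Cd := one_pos.trans_le hX.hCd
  set c := (sobolevConst Cd CP lam).toReal with hc
  have hc0 : 0 ≤ c := ENNReal.toReal_nonneg
  have hcC : sobolevConst Cd CP lam = ENNReal.ofReal c :=
    (ENNReal.ofReal_toReal (by rw [sobolevConst]; finiteness)).symm
  obtain ⟨N, hN⟩ := pow_unbounded_of_one_lt (max (8 * (1 + lam)) (32 * c * Cd)) one_lt_two
  have hN1 := (le_max_left _ _).trans hN.le
  have hN2 := (le_max_right _ _).trans hN.le
  refine ⟨(Cd ^ (N + 1))⁻¹ / 8, by positivity, fun u hu hT x R k d hR hd hmin hE => ?_⟩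
  have hlocfin := hX.isLocallyFiniteMeasure
  have hproper := hX.properSpace
  set σ := (Cd ^ (N + 1))⁻¹ / 8 with hσ
  have hσ0 : 0 < σ := by positivity
  set τ := (2 * Cd)⁻¹ with hτ
  have hτ0 : 0 < τ := by positivity
  set M := μ (ball x R) with hM
  have hM0 : M ≠ 0 := (hX.measure_ball_pos x hR).ne'
  have hMt : M ≠ ⊤ := (hX.measure_ball_lt_top x R).ne
  set ρ : ℕ → ℝ := fun j => R / 2 * (1 + (1 / 2) ^ j) with hρ
  set κ : ℕ → ℝ := fun j => k + d * (1 - (1 / 2) ^ j) with hκ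
  have hρdiff : ∀ j, ρ j - ρ (j + 1) = R * (1 / 2) ^ j / 4 := fun j => by
    simp only [hρ, pow_succ]; ring
  have hκdiff : ∀ j, κ (j + 1) - κ j = d * (1 / 2) ^ j / 2 := fun j => by
    simp only [hκ, pow_succ]; ring
  have hhalf : ∀ j : ℕ, (0 : ℝ) < (1 / 2) ^ j := fun j => by positivity
  have hhalf1 : ∀ j : ℕ, ((1 : ℝ) / 2) ^ j ≤ 1 := fun j => pow_le_one₀ (by norm_num) (by norm_num)
  have hρR : ∀ j, ρ j ≤ R := fun j => by
    have := hhalf1 j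
    simp only [hρ]; nlinarith
  have hκk : ∀ j, k ≤ κ j := fun j => by
    have := hhalf1 j
    simp only [hκ]; nlinarith
  have claim : ∀ j, ∫⁻ z in ball x (ρ j), ENNReal.ofReal (u z - κ j) ∂μ ≤
      ENNReal.ofReal (τ ^ j * (σ * d)) * M := by
    intro j
    induction j with
    | zero =>
      have h1 : ρ 0 = R := by simp only [hρ, pow_zero]; ring
      have h2 : κ 0 = k := by simp only [hκ, pow_zero]; ring
      rw [h1, h2, pow_zero, one_mul]
      exact hE
    | succ j ih =>
      set r := R * (1 / 2) ^ j / 2 ^ N with hr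
      have hr0 : 0 < r := by positivity
      have h2N : (0 : ℝ) < 2 ^ N := by positivity
      have hρlt : ρ (j + 1) < ρ j := by
        have := hρdiff j
        have := mul_pos hR (hhalf j)
        linarith
      have hκlt : κ j < κ (j + 1) := by
        have := hκdiff j
        have := mul_pos hd (hhalf j)
        linarith
      have hrρ : 2 * (1 + lam) * r ≤ ρ j - ρ (j + 1) := by
        rw [hρdiff, hr, mul_div_assoc', div_le_div_iff₀ h2N (by norm_num)]
        have := mul_le_mul_of_nonneg_left hN1 (mul_pos hR (hhalf j)).le
        linarith
      have hrle : ρ (j + 1) + r ≤ R := by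
        have h1 := hρR j
        have h2 : r ≤ 2 * (1 + lam) * r := le_mul_of_one_le_left hr0.le (by linarith [hX.hlam])
        linarith
      have hm : ∀ y ∈ ball x (ρ (j + 1) + r),
          ENNReal.ofReal ((Cd ^ (N + j + 1))⁻¹) * M ≤ μ (ball y r) := by
        intro y hy
        rw [mem_ball, dist_comm] at hy
        have h1 := hX.measure_ball_le (x := x) (y := y) (R := R) hr0 (n := N + j + 1) (by
          have : (2 : ℝ) ^ (N + j + 1) * r = 2 * R := by
            rw [hr, pow_succ, pow_add]
            field_simp
            rw [← mul_pow]; norm_num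
          rw [this]; linarith)
        rw [← ENNReal.ofReal_pow hCd0.le] at h1
        calc _ ≤ ENNReal.ofReal ((Cd ^ (N + j + 1))⁻¹) *
              (ENNReal.ofReal (Cd ^ (N + j + 1)) * μ (ball y r)) := mul_le_mul_right h1 _
          _ = _ := by
              rw [← mul_assoc, ← ENNReal.ofReal_mul (by positivity),
                inv_mul_cancel₀ (by positivity), ENNReal.ofReal_one, one_mul]
      have hex : 2 * ∫⁻ z in ball x (ρ j), ENNReal.ofReal (u z - κ j) ∂μ <
          ENNReal.ofReal ((Cd ^ (N + j + 1))⁻¹) * M * ENNReal.ofReal (κ (j + 1) - κ j) := by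
        refine (mul_le_mul_right ih 2).trans_lt ?_
        rw [mul_right_comm, ← ENNReal.ofReal_mul (by positivity), ← mul_assoc,
          show (2 : ℝ≥0∞) = ENNReal.ofReal 2 by simp, ← ENNReal.ofReal_mul (by norm_num)]
        refine (ENNReal.mul_lt_mul_iff_left hM0 hMt).2 ((ENNReal.ofReal_lt_ofReal_iff ?_).2 ?_)
        · have := sub_pos.2 hκlt
          positivity
        · rw [hκdiff, hτ, hσ]
          have e1 : 2 * ((2 * Cd)⁻¹ ^ j * ((Cd ^ (N + 1))⁻¹ / 8 * d)) =
              (Cd ^ (N + j + 1))⁻¹ * (d * (1 / 2) ^ j) / 4 := by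
            rw [mul_inv, mul_pow, one_div, show N + j + 1 = j + (N + 1) by ring, pow_add Cd j,
              mul_inv, inv_pow Cd]
            ring
          rw [e1, mul_div_assoc', div_lt_div_iff₀ (by norm_num) (by norm_num)]
          have := mul_pos (inv_pos.2 (pow_pos hCd0 (N + j + 1))) (mul_pos hd (hhalf j))
          linarith
      have hstep := hX.excess_step hu hT hρlt hr0 hrρ hκlt
        ((hmin _ (hκk _)).mono (hρR j)) hm hex
      have hfac : c * r * (4 / (ρ j - ρ (j + 1))) ≤ τ := by
        rw [hρdiff, hr, hτ]
        have : c * (R * (1 / 2) ^ j / 2 ^ N) * (4 / (R * (1 / 2) ^ j / 4)) = 16 * c / 2 ^ N := by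
          have := hhalf j
          field_simp
          ring
        rw [this, ← one_div, div_le_div_iff₀ h2N (by positivity)]
        linarith
      calc _ ≤ _ := hstep
        _ = ENNReal.ofReal (c * r * (4 / (ρ j - ρ (j + 1)))) *
              ∫⁻ z in ball x (ρ j), ENNReal.ofReal (u z - κ (j + 1)) ∂μ := by
            rw [hcC, ENNReal.ofReal_mul (by positivity), ENNReal.ofReal_mul hc0]; ring
        _ ≤ ENNReal.ofReal τ * (ENNReal.ofReal (τ ^ j * (σ * d)) * M) := by
            refine mul_le_mul' (ENNReal.ofReal_le_ofReal hfac) (le_trans ?_ ih)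
            exact lintegral_mono fun z => ENNReal.ofReal_le_ofReal (by linarith)
        _ = _ := by
            rw [← mul_assoc, ← ENNReal.ofReal_mul hτ0.le, pow_succ']; ring_nf
  have hτ1 : τ < 1 := by
    rw [hτ]; exact inv_lt_one_of_one_lt₀ (by linarith [hX.hCd])
  have hzero : ∫⁻ z in ball x (R / 2), ENNReal.ofReal (u z - (k + d)) ∂μ = 0 := by
    refine le_antisymm (ge_of_tendsto' (x := atTop)
      (f := fun j : ℕ => ENNReal.ofReal (τ ^ j * (σ * d)) * M) ?_ fun j => ?_) zero_le
    · have h1 : Tendsto (fun j : ℕ => τ ^ j * (σ * d)) atTop (𝓝 (0 * (σ * d))) :=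
        (tendsto_pow_atTop_nhds_zero_of_lt_one hτ0.le hτ1).mul_const _
      have h2 := ENNReal.Tendsto.mul_const (ENNReal.tendsto_ofReal h1) (Or.inr hMt)
      simpa using h2
    · refine le_trans ?_ (claim j)
      refine (lintegral_mono_set (ball_subset_ball ?_)).trans (lintegral_mono fun z => ?_)
      · have := mul_pos hR (hhalf j)
        simp only [hρ]; linarith
      · have := mul_pos hd (hhalf j)
        exact ENNReal.ofReal_le_ofReal (by simp only [hκ]; linarith)
  have hum : AEMeasurable u μ := hu.aestronglyMeasurable.aemeasurable
  rw [lintegral_eq_zero_iff' (hum.sub_const _).ennreal_ofReal.restrict] at hzero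
  filter_upwards [hzero] with z hz
  have := ENNReal.ofReal_eq_zero.1 hz
  linarith

end LocalBound

section Finiteness

variable {μ : Measure X}

lemma MemBVloc.locallyIntegrable {u : X → ℝ} (h : MemBVloc μ u univ) : LocallyIntegrable u μ := by
  intro x
  obtain ⟨U, hU, hxU, -, hint, -⟩ := h {x} isCompact_singleton (subset_univ _)
  exact ⟨U, hU.mem_nhds (hxU rfl), hint⟩

lemma tv_neg_le (u : X → ℝ) (U : Set X) : tv μ (fun z => -u z) U ≤ tv μ u U := by
  refine le_iInf₂ fun v hv => le_iInf₂ fun hvu g => le_iInf₂ fun hg hgv => ?_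
  refine tv_le_liminf (v := fun i z => -v i z) (fun i => (hv i).neg) (hvu.mono_fun fun i z => ?_)
    hg fun i => ?_
  · rw [show -v i z - -u z = -(v i z - u z) by ring, abs_neg]
  · obtain ⟨Γ, hΓ, h⟩ := hgv i
    refine ⟨Γ, hΓ, fun γ hγ hγU => ?_⟩
    have := h γ hγ hγU
    rwa [show -v i (γ.toFun 1) - -v i (γ.toFun 0) = -(v i (γ.toFun 1) - v i (γ.toFun 0)) by ring,
      abs_neg]

lemma tv_neg (u : X → ℝ) (U : Set X) : tv μ (fun z => -u z) U = tv μ u U :=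
  (tv_neg_le u U).antisymm (by simpa using tv_neg_le (μ := μ) (fun z => -u z) U)

lemma tv_mono (u : X → ℝ) {U V : Set X} (h : U ⊆ V) : tv μ u U ≤ tv μ u V := by
  refine le_iInf₂ fun v hv => le_iInf₂ fun hvu g => le_iInf₂ fun hg hgv => ?_
  refine (tv_le_liminf (fun i K hK hKU => hv i K hK (hKU.trans h))
    (fun K hK hKU => hvu K hK (hKU.trans h)) hg fun i => ?_).trans
    (liminf_le_liminf (Eventually.of_forall fun i => lintegral_mono_set h))
  obtain ⟨Γ, hΓ, hg⟩ := hgv i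
  exact ⟨Γ, hΓ, fun γ hγ hγU => hg γ hγ fun t ht => h (hγU t ht)⟩

/-- A function of finite total variation near a compact set `K` that agrees outside `K` with a
function of finite total variation has finite total variation. -/
lemma tv_ne_top_of_ae_eq_outside [BorelSpace X] [ProperSpace X] {u f : X → ℝ} {K U : Set X}
    (hK : IsCompact K) (hKne : K.Nonempty) (hU : IsOpen U) (hKU : K ⊆ U) (hu : tv μ u U ≠ ⊤)
    (hfint : LocallyIntegrable f μ) (hf : tv μ f univ ≠ ⊤)
    (heq : ∀ᵐ z ∂μ, z ∉ K → u z = f z) : tv μ u univ ≠ ⊤ := by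
  obtain ⟨δ, hδ, hδU⟩ := hK.exists_cthickening_subset_open hU hKU
  have hthick : ∀ {z}, infDist z K ≤ δ / 2 → z ∈ cthickening δ K := fun {z} hz =>
    thickening_subset_cthickening _ _ ((mem_thickening_iff_infDist_lt hKne).2 (by linarith))
  obtain ⟨η, hηL, hη0, hη1, hηone, -, hS, hηsupp⟩ :=
    exists_cutoff K (a := δ / 4) (b := δ / 2) (by linarith)
  set L := Real.toNNReal (1 / (δ / 2 - δ / 4)) with hL
  set S := {z | δ / 4 ≤ infDist z K ∧ infDist z K ≤ δ / 2} with hSdef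
  have hc : Continuous fun z => infDist z K := continuous_infDist_pt K
  have hScl : IsClosed S :=
    (isClosed_le continuous_const hc).inter (isClosed_le hc continuous_const)
  have hcomp : IsCompact (cthickening δ K) :=
    isCompact_of_isClosed_isBounded isClosed_cthickening hK.isBounded.cthickening
  have hScomp : IsCompact S := hcomp.of_isClosed_subset hScl fun z hz => hthick hz.2
  have hSU : S ⊆ U := fun z hz => hδU (hthick hz.2)
  have hSK : ∀ z ∈ S, z ∉ K := fun z hz hzK => by
    have := hz.1
    rw [infDist_zero_of_mem hzK] at this
    linarith
  have hTcomp : IsCompact (tsupport η) :=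
    hcomp.of_isClosed_subset (isClosed_tsupport η) fun z hz => hthick (hηsupp hz)
  have hηU : tsupport η ⊆ U := fun z hz => hδU (hthick (hηsupp hz))
  obtain ⟨a, ga, ha, hau, hgam, hga, hgaT⟩ := exists_approx hu one_ne_zero
  obtain ⟨b, gb, hb, hbf, hgbm, hgb, hgbT⟩ := exists_approx hf one_ne_zero
  simp only [setLIntegral_univ] at hgbT
  have hUm := hU.measurableSet
  have hgaT' : ∀ i, ∫⁻ z, U.indicator (ga i) z ∂μ ≤ tv μ u U + 1 := fun i => by
    rw [lintegral_indicator hUm]; exact hgaT i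
  have hfin1 : tv μ u U + 1 ≠ ⊤ := ENNReal.add_ne_top.2 ⟨hu, ENNReal.one_ne_top⟩
  have hfin2 : tv μ f univ + 1 ≠ ⊤ := ENNReal.add_ne_top.2 ⟨hf, ENNReal.one_ne_top⟩
  have hbm : ∀ i, Measurable (b i) := fun i => (hb i).continuous.measurable
  have hfm : ∀ i (s : Set X), AEMeasurable (fun z => ENNReal.ofReal |b i z - f z|) (μ.restrict s) :=
    fun i s => ((hbm i).aemeasurable.sub
      hfint.aestronglyMeasurable.aemeasurable.restrict).norm.ennreal_ofReal
  have hloc : ∀ i, LocLipschitzOn (fun z => η z * a i z + (1 - η z) * b i z) univ := fun i =>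
    (ha i).glue (hb i) hηL hη0 hη1 hηU
  have hglue := fun i => isWeakUpperGradientOn_glue hU hηL hη0 hη1 hS hηU (hga i).indicator (hgb i)
    ((hgam i).indicator hUm) (hgbm i) ((hgaT' i).trans_lt hfin1.lt_top).ne
    ((hgbT i).trans_lt hfin2.lt_top).ne (hloc i)
  have hconv : TendstoL1Loc μ (fun i z => η z * a i z + (1 - η z) * b i z) u univ := by
    intro C hC _
    have hlim := (hau _ (hC.inter_right (isClosed_tsupport η)) (inter_subset_right.trans hηU)).add
      (hbf C hC (subset_univ _))
    rw [add_zero] at hlim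
    refine tendsto_of_tendsto_of_tendsto_of_le_of_le tendsto_const_nhds hlim (fun _ => zero_le)
      fun i => ?_
    dsimp only
    rw [inter_comm, ← Measure.restrict_restrict (isClosed_tsupport η).measurableSet,
      ← lintegral_indicator (isClosed_tsupport η).measurableSet, ← lintegral_add_right' _ (hfm i C)]
    refine lintegral_mono_ae (ae_restrict_of_ae ?_)
    filter_upwards [heq] with z hz
    have hfb : |(1 - η z) * (b i z - u z)| ≤ |b i z - f z| := by
      by_cases hzK : z ∈ K
      · rw [hηone z (by rw [infDist_zero_of_mem hzK]; positivity), sub_self, zero_mul, abs_zero]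
        exact abs_nonneg _
      · rw [hz hzK, abs_mul, abs_of_nonneg (sub_nonneg.2 (hη1 z))]
        exact mul_le_of_le_one_left (abs_nonneg _) (by linarith [hη0 z])
    rw [show η z * a i z + (1 - η z) * b i z - u z =
      η z * (a i z - u z) + (1 - η z) * (b i z - u z) by ring]
    refine (ENNReal.ofReal_le_ofReal (abs_add_le _ _)).trans ?_
    rw [ENNReal.ofReal_add (abs_nonneg _) (abs_nonneg _)]
    refine add_le_add ?_ (ENNReal.ofReal_le_ofReal hfb)
    by_cases hzT : z ∈ tsupport η
    · rw [indicator_of_mem hzT, abs_mul, abs_of_nonneg (hη0 z)]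
      exact ENNReal.ofReal_le_ofReal (mul_le_of_le_one_left (abs_nonneg _) (hη1 z))
    · rw [image_eq_zero_of_notMem_tsupport hzT]
      simp
  have hm1 : ∀ i, Measurable fun z => ENNReal.ofReal (η z) * U.indicator (ga i) z := fun i =>
    hηL.continuous.measurable.ennreal_ofReal.mul ((hgam i).indicator hUm)
  have hm2 : ∀ i, Measurable fun z => ENNReal.ofReal (1 - η z) * gb i z := fun i =>
    (measurable_const.sub hηL.continuous.measurable).ennreal_ofReal.mul (hgbm i)
  have hm3 : ∀ i, Measurable (S.indicator fun z => ENNReal.ofReal (|a i z - b i z| * L)) := by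
    intro i
    classical
    obtain ⟨M, hM⟩ := ha i S hScomp hSU
    rw [← piecewise_eq_indicator]
    refine ContinuousOn.measurable_piecewise ?_ continuousOn_const hScl.measurableSet
    exact ENNReal.continuous_ofReal.comp_continuousOn
      (((hM.continuousOn.sub (hb i).continuous.continuousOn).abs).mul continuousOn_const)
  have hle := tv_le_liminf (g := fun i => glueGrad η (a i) (b i) L S (U.indicator (ga i)) (gb i))
    hloc hconv (fun i => ((hm1 i).add (hm2 i)).add (hm3 i)) hglue
  simp only [setLIntegral_univ] at hle
  have hSlim : Tendsto (fun i => ∫⁻ z in S, ENNReal.ofReal |a i z - b i z| ∂μ) atTop (𝓝 0) := by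
    have hlim := (hau S hScomp hSU).add (hbf S hScomp (subset_univ _))
    rw [add_zero] at hlim
    refine tendsto_of_tendsto_of_tendsto_of_le_of_le tendsto_const_nhds hlim (fun _ => zero_le)
      fun i => ?_
    dsimp only
    rw [← lintegral_add_right' _ (hfm i S)]
    refine lintegral_mono_ae ?_
    filter_upwards [ae_restrict_of_ae heq, ae_restrict_mem hScl.measurableSet] with z hz hzS
    rw [← ENNReal.ofReal_add (abs_nonneg _) (abs_nonneg _), hz (hSK z hzS), abs_sub_comm (b i z)]
    exact ENNReal.ofReal_le_ofReal (abs_sub_le _ _ _)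
  set C := tv μ u U + 1 + (tv μ f univ + 1) + L with hC
  have hCt : C ≠ ⊤ := ENNReal.add_ne_top.2 ⟨ENNReal.add_ne_top.2 ⟨hfin1, hfin2⟩, by simp⟩
  refine ne_top_of_le_ne_top hCt (hle.trans (not_lt.1 fun hlt => ?_))
  obtain ⟨i, hi1, hi2⟩ := ((eventually_lt_of_lt_liminf hlt).and
    (hSlim.eventually_lt_const one_pos)).exists
  refine hi1.not_ge ?_
  simp only [glueGrad]
  have hm12 : Measurable fun z => ENNReal.ofReal (η z) * U.indicator (ga i) z +
      ENNReal.ofReal (1 - η z) * gb i z := (hm1 i).add (hm2 i)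
  rw [lintegral_add_left hm12, lintegral_add_left (hm1 i)]
  refine add_le_add (add_le_add ((lintegral_mono fun z => ?_).trans (hgaT' i))
    ((lintegral_mono fun z => ?_).trans (hgbT i))) ?_
  · exact mul_le_of_le_one_left' (ENNReal.ofReal_le_one.2 (hη1 z))
  · exact mul_le_of_le_one_left' (ENNReal.ofReal_le_one.2 (by linarith [hη0 z]))
  · rw [lintegral_indicator hScl.measurableSet]
    calc _ = ∫⁻ z in S, L * ENNReal.ofReal |a i z - b i z| ∂μ := lintegral_congr fun z => by
          rw [ENNReal.ofReal_mul' L.coe_nonneg, ENNReal.ofReal_coe_nnreal, mul_comm]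
      _ = L * ∫⁻ z in S, ENNReal.ofReal |a i z - b i z| ∂μ :=
          lintegral_const_mul' _ _ ENNReal.coe_ne_top
      _ ≤ L * 1 := by gcongr
      _ = L := mul_one _

end Finiteness

section ApproximateLimits

variable {μ : Measure X} {Cd CP lam : ℝ}

lemma upperApprox_le_of_ae_le [OpensMeasurableSpace X] {u : X → ℝ} {M ρ : ℝ} {x y : X}
    (h : ∀ᵐ z ∂μ.restrict (ball x ρ), u z ≤ M) (hy : y ∈ ball x ρ) : upperApprox μ u y ≤ M := by
  refine sInf_le ⟨M, ?_, rfl⟩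
  refine tendsto_const_nhds.congr' ?_
  filter_upwards [Ioo_mem_nhdsGT (sub_pos.2 (mem_ball.1 hy))] with r hr
  have hsub : ball y r ⊆ ball x ρ := ball_subset_ball' (by linarith [hr.2])
  have h0 : μ.restrict (ball y r) {z | M < u z} = 0 := by
    have := ae_restrict_of_ae_restrict_of_subset hsub h
    simpa [ae_iff] using this
  rw [Measure.restrict_apply' measurableSet_ball] at h0
  rw [h0, ENNReal.zero_div]

lemma MMS.le_upperApprox_of_ae_le [OpensMeasurableSpace X] (hX : MMS μ Cd CP lam) {u : X → ℝ}
    {m ρ : ℝ} {x y : X} (h : ∀ᵐ z ∂μ.restrict (ball x ρ), m ≤ u z) (hy : y ∈ ball x ρ) :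
    (m : EReal) ≤ upperApprox μ u y := by
  refine le_sInf ?_
  rintro _ ⟨t, ht, rfl⟩
  by_contra! hlt
  rw [EReal.coe_lt_coe_iff] at hlt
  refine one_ne_zero (tendsto_nhds_unique (tendsto_const_nhds.congr' ?_) ht)
  filter_upwards [Ioo_mem_nhdsGT (sub_pos.2 (mem_ball.1 hy))] with r hr
  have hsub : ball y r ⊆ ball x ρ := ball_subset_ball' (by linarith [hr.2])
  have h1 : μ ({z | t < u z} ∩ ball y r) = μ (ball y r) := by
    rw [← Measure.restrict_apply' measurableSet_ball, ← Measure.restrict_apply_univ (ball y r)]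
    refine measure_congr (eventuallyEq_univ.2 ?_)
    filter_upwards [ae_restrict_of_ae_restrict_of_subset hsub h] with z hz
    exact hlt.trans_le hz
  rw [h1, ENNReal.div_self (hX.measure_ball_pos y hr.1).ne' (hX.measure_ball_lt_top y r).ne]

lemma upperApproxE_le_upperApprox {u : X → ℝ} {ψ : X → EReal} {Ω : Set X} {x : X}
    (hΩ : IsOpen Ω) (hx : x ∈ Ω) (h : ∀ᵐ z ∂μ, z ∈ Ω → ψ z ≤ u z) :
    upperApproxE μ ψ x ≤ upperApprox μ u x := by
  refine sInf_le_sInf (image_mono fun t ht => ?_)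
  obtain ⟨ρ, hρ, hρΩ⟩ := Metric.isOpen_iff.1 hΩ x hx
  refine tendsto_of_tendsto_of_tendsto_of_le_of_le' tendsto_const_nhds ht
    (Eventually.of_forall fun _ => zero_le) ?_
  filter_upwards [Ioo_mem_nhdsGT hρ] with r hr
  refine ENNReal.div_le_div_right (measure_mono_ae ?_) _
  filter_upwards [h] with z hz hzt
  have hzΩ : z ∈ Ω := hρΩ (ball_subset_ball hr.2.le hzt.2)
  have hlt : (t : EReal) < u z := lt_of_lt_of_le hzt.1 (hz hzΩ)
  exact ⟨EReal.coe_lt_coe_iff.1 hlt, hzt.2⟩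

lemma exists_ball_ae_le_of_iInf_essSup_lt {ψ : X → EReal} {x : X} {k : EReal}
    (h : ⨅ (r : ℝ) (_ : 0 < r), essSup ψ (μ.restrict (ball x r)) < k) :
    ∃ r > 0, ∀ᵐ z ∂μ.restrict (ball x r), ψ z ≤ k := by
  simp only [iInf_lt_iff] at h
  obtain ⟨r, hr, h⟩ := h
  exact ⟨r, hr, (ae_lt_of_essSup_lt h).mono fun z hz => hz.le⟩

end ApproximateLimits

section Obstacle

variable {μ : Measure X} {Cd CP lam : ℝ}

lemma memBVloc_of_locallyIntegrable [OpensMeasurableSpace X] [ProperSpace X] {v : X → ℝ}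
    (hv : LocallyIntegrable v μ) (ht : tv μ v univ ≠ ⊤) : MemBVloc μ v univ := by
  intro K hK _
  refine ⟨thickening 1 K, isOpen_thickening, self_subset_thickening one_pos K, subset_univ _,
    (hv.integrableOn_isCompact (isCompact_of_isClosed_isBounded isClosed_cthickening
      hK.isBounded.cthickening)).mono_set (thickening_subset_cthickening 1 K),
    (tv_mono v (subset_univ _)).trans_lt ht.lt_top⟩

lemma IsObstacleSolution.tv_le_blend [BorelSpace X] [ProperSpace X] [IsLocallyFiniteMeasure μ]
    {ψ : X → EReal} {f u w η : X → ℝ} {Ω : Set X} {L : ℝ≥0} {C : ℝ}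
    (hu : IsObstacleSolution μ ψ f Ω u) (hw : AEStronglyMeasurable w μ)
    (hwu : ∀ z, |w z| ≤ |u z| + C) (hψw : ∀ᵐ z ∂μ, z ∈ tsupport η → ψ z ≤ w z)
    (hηL : LipschitzWith L η) (hη0 : ∀ z, 0 ≤ η z) (hη1 : ∀ z, η z ≤ 1) (hηΩ : tsupport η ⊆ Ω) :
    tv μ u univ ≤ tv μ (fun z => η z * w z + (1 - η z) * u z) univ := by
  rcases eq_or_ne (tv μ (fun z => η z * w z + (1 - η z) * u z) univ) ⊤ with ht | ht
  · rw [ht]; exact le_top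
  have hint := hu.1.1.locallyIntegrable
  have hηm : AEStronglyMeasurable η μ := hηL.continuous.aestronglyMeasurable
  have hC : ∀ z, 0 ≤ |u z| + C := fun z => (abs_nonneg _).trans (hwu z)
  refine hu.2 _ ⟨memBVloc_of_locallyIntegrable ?_ ht, ?_, ?_⟩
  · have hnorm : LocallyIntegrable (fun z => |u z|) μ := fun z => (hint z).norm
    refine (hnorm.add (locallyIntegrable_const |C|)).mono
      ((hηm.mul hw).add ((aestronglyMeasurable_const.sub hηm).mul hint.aestronglyMeasurable))
      (Eventually.of_forall fun z => ?_)
    have hη' : 0 ≤ 1 - η z := sub_nonneg.2 (hη1 z)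
    have h1 : |w z| ≤ |u z| + |C| := (hwu z).trans (by gcongr; exact le_abs_self C)
    have h2 : |u z| ≤ |u z| + |C| := le_add_of_nonneg_right (abs_nonneg C)
    calc |η z * w z + (1 - η z) * u z| ≤ η z * |w z| + (1 - η z) * |u z| := by
          refine (abs_add_le _ _).trans (le_of_eq ?_)
          rw [abs_mul, abs_mul, abs_of_nonneg (hη0 z), abs_of_nonneg hη']
      _ ≤ η z * (|u z| + |C|) + (1 - η z) * (|u z| + |C|) := by gcongr; exact hη0 z
      _ = |u z| + |C| := by ring
      _ ≤ ‖|u z| + |C|‖ := le_abs_self _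
  · filter_upwards [hu.1.2.1, hψw] with z hzu hzw hzΩ
    by_cases hz : z ∈ tsupport η
    · have hmin : ψ z ≤ ((min (w z) (u z) : ℝ) : EReal) := by
        rcases min_choice (w z) (u z) with h | h <;> rw [h]
        exacts [hzw hz, hzu hzΩ]
      refine hmin.trans (EReal.coe_le_coe_iff.2 ?_)
      nlinarith [hη0 z, hη1 z, min_le_left (w z) (u z), min_le_right (w z) (u z)]
    · rw [image_eq_zero_of_notMem_tsupport hz]
      simpa using hzu hzΩ
  · filter_upwards [hu.1.2.2] with z hz hzΩ
    rw [image_eq_zero_of_notMem_tsupport fun h => hzΩ (hηΩ h)]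
    simpa using hz hzΩ

lemma IsObstacleSolution.truncMin [BorelSpace X] [ProperSpace X] [IsLocallyFiniteMeasure μ]
    {ψ : X → EReal} {f u : X → ℝ} {Ω : Set X} {x : X} {R k : ℝ}
    (hu : IsObstacleSolution μ ψ f Ω u) (hRΩ : closedBall x R ⊆ Ω)
    (hk : ∀ᵐ z ∂μ.restrict (closedBall x R), ψ z ≤ k) : TruncMin μ u k x R := by
  intro η L hηL hη0 hη1 hηR
  refine hu.tv_le_blend (C := |k|) (hu.1.1.locallyIntegrable.aestronglyMeasurable.inf
    aestronglyMeasurable_const) (fun z => ?_) ?_ hηL hη0 hη1 (hηR.trans hRΩ)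
  · rcases min_choice (u z) k with h | h <;> rw [h]
    · exact le_add_of_nonneg_right (abs_nonneg k)
    · exact le_add_of_nonneg_left (abs_nonneg _)
  · filter_upwards [hu.1.2.1, (ae_restrict_iff' measurableSet_closedBall).1 hk] with z hzu hzk hz
    rcases min_choice (u z) k with h | h <;> rw [h]
    exacts [hzu (hRΩ (hηR hz)), hzk (hηR hz)]

lemma IsObstacleSolution.truncMin_neg [BorelSpace X] [ProperSpace X] [IsLocallyFiniteMeasure μ]
    {ψ : X → EReal} {f u : X → ℝ} {Ω : Set X} {x : X} {R : ℝ}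
    (hu : IsObstacleSolution μ ψ f Ω u) (hRΩ : closedBall x R ⊆ Ω) (k : ℝ) :
    TruncMin μ (fun z => -u z) k x R := by
  intro η L hηL hη0 hη1 hηR
  have heq : (fun z => η z * min (-u z) k + (1 - η z) * -u z) =
      fun z => -(η z * max (u z) (-k) + (1 - η z) * u z) := by
    ext z
    have hmin : min (-u z) k = -max (u z) (-k) := by rw [← min_neg_neg, neg_neg]
    rw [hmin]; ring
  rw [heq, tv_neg, tv_neg]
  refine hu.tv_le_blend (C := |k|) (hu.1.1.locallyIntegrable.aestronglyMeasurable.sup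
    aestronglyMeasurable_const) (fun z => ?_) ?_ hηL hη0 hη1 (hηR.trans hRΩ)
  · rcases max_choice (u z) (-k) with h | h <;> rw [h]
    · exact le_add_of_nonneg_right (abs_nonneg k)
    · rw [abs_neg]; exact le_add_of_nonneg_left (abs_nonneg _)
  · filter_upwards [hu.1.2.1] with z hzu hz
    exact (hzu (hRΩ (hηR hz))).trans (EReal.coe_le_coe_iff.2 (le_max_left _ _))

lemma IsObstacleSolution.tv_ne_top [BorelSpace X] [ProperSpace X] {ψ : X → EReal} {f u : X → ℝ}
    {Ω : Set X} (hu : IsObstacleSolution μ ψ f Ω u) (hΩne : Ω.Nonempty)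
    (hΩbdd : Bornology.IsBounded Ω) (hf : LocallyIntegrable f μ) (hDf : tv μ f univ < ⊤) :
    tv μ u univ ≠ ⊤ := by
  have hcomp : IsCompact (closure Ω) := hΩbdd.isCompact_closure
  obtain ⟨U, hU, hKU, -, -, htv⟩ := hu.1.1 _ hcomp (subset_univ _)
  refine tv_ne_top_of_ae_eq_outside hcomp hΩne.closure hU hKU htv.ne hf hDf.ne ?_
  filter_upwards [hu.1.2.2] with z hz hzΩ
  exact hz fun h => hzΩ (subset_closure h)

lemma MMS.exists_ae_le_of_truncMin [BorelSpace X] (hX : MMS μ Cd CP lam) {u : X → ℝ}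
    (hu : LocallyIntegrable u μ) (hT : tv μ u univ ≠ ⊤) {x : X} {R k : ℝ} (hR : 0 < R)
    (hmin : ∀ k' ≥ k, TruncMin μ u k' x R) :
    ∃ M : ℝ, ∀ᵐ z ∂μ.restrict (ball x (R / 2)), u z ≤ M := by
  obtain ⟨σ, hσ, hbound⟩ := hX.exists_local_bound
  have hproper := hX.properSpace
  have hlocfin := hX.isLocallyFiniteMeasure
  have hB0 := (hX.measure_ball_pos x hR).ne'
  have hBt := (hX.measure_ball_lt_top x R).ne
  set I := ∫⁻ z in ball x R, ENNReal.ofReal (u z - k) ∂μ with hI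
  have hIt : I ≠ ⊤ := by
    have hint : IntegrableOn (fun z => u z - k) (ball x R) μ :=
      ((hu.sub (locallyIntegrable_const k)).integrableOn_isCompact
        (isCompact_closedBall x R)).mono_set ball_subset_closedBall
    exact ((lintegral_ofReal_le_lintegral_enorm _).trans_lt hint.2).ne
  have hIB : I / μ (ball x R) ≠ ⊤ := ENNReal.div_ne_top hIt hB0
  refine ⟨_, hbound u hu hT x R k ((I / μ (ball x R)).toReal / σ + 1) hR (by positivity) hmin ?_⟩
  rw [← ENNReal.div_le_iff hB0 hBt]
  refine ENNReal.le_ofReal_iff_toReal_le hIB (by positivity) |>.2 ?_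
  rw [mul_add, mul_div_cancel₀ _ hσ.ne']
  linarith

lemma MMS.exists_ball_ae_le [BorelSpace X] (hX : MMS μ Cd CP lam) {u : X → ℝ}
    (hu : LocallyIntegrable u μ) (hT : tv μ u univ ≠ ⊤) {x : X} {R k d : ℝ} (hR : 0 < R)
    (hd : 0 < d) (hmin : ∀ k' ≥ k, TruncMin μ u k' x R) (hk : upperApprox μ u x < k) :
    ∃ r > 0, ∀ᵐ z ∂μ.restrict (ball x r), u z ≤ k + d := by
  obtain ⟨M, hM⟩ := hX.exists_ae_le_of_truncMin hu hT hR hmin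
  obtain ⟨σ, hσ, hbound⟩ := hX.exists_local_bound
  obtain ⟨_, ⟨t, ht, rfl⟩, htk⟩ := sInf_lt_iff.1 hk
  rw [EReal.coe_lt_coe_iff] at htk
  set D := max (M - k) 0 + 1 with hD
  have hD0 : 0 < D := by positivity
  have hε : 0 < ENNReal.ofReal (σ * d / D) := ENNReal.ofReal_pos.2 (by positivity)
  obtain ⟨r, hrε, hr0, hrR⟩ := ((Tendsto.eventually_lt_const hε ht).and
    (Ioo_mem_nhdsGT (half_pos hR))).exists
  refine ⟨r / 2, half_pos hr0, hbound u hu hT x r k d hr0 hd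
    (fun k' hk' => (hmin k' hk').mono (by linarith)) ?_⟩
  have hle : μ ({y | t < u y} ∩ ball x r) ≤ ENNReal.ofReal (σ * d / D) * μ (ball x r) :=
    (ENNReal.div_le_iff (hX.measure_ball_pos x hr0).ne' (hX.measure_ball_lt_top x r).ne).1 hrε.le
  calc ∫⁻ z in ball x r, ENNReal.ofReal (u z - k) ∂μ
      ≤ ∫⁻ z in ball x r, {y | t < u y}.indicator (fun _ => ENNReal.ofReal D) z ∂μ := by
        refine lintegral_mono_ae ?_
        filter_upwards [ae_restrict_of_ae_restrict_of_subset (ball_subset_ball hrR.le) hM]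
          with z hz
        by_cases h : t < u z
        · rw [indicator_of_mem (by exact h)]
          exact ENNReal.ofReal_le_ofReal (by linarith [le_max_left (M - k) 0])
        · rw [ENNReal.ofReal_of_nonpos (by linarith)]
          exact zero_le
    _ ≤ ENNReal.ofReal D * μ ({y | t < u y} ∩ ball x r) := by
        rw [← Measure.restrict_apply' measurableSet_ball]
        exact lintegral_indicator_const_le _ _
    _ ≤ ENNReal.ofReal D * (ENNReal.ofReal (σ * d / D) * μ (ball x r)) := by gcongr
    _ = ENNReal.ofReal (σ * d) * μ (ball x r) := by
        rw [← mul_assoc, ← ENNReal.ofReal_mul hD0.le, mul_div_cancel₀ _ hD0.ne']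

end Obstacle

/-- **Semicontinuity for solutions of obstacle problems.** Let `u` solve the
`K_{ψ,f}(Ω)`-obstacle problem and let `x ∈ Ω` satisfy `ψ^∨(x) = esslimsup_{y→x} ψ(y)`.
Then `u^∨` is upper semicontinuous at `x` (as a `[-∞,∞]`-valued function); moreover, if
`ψ^∨(x) < ∞`, then `u^∨` is real-valued in a neighborhood of `x` and upper semicontinuous
at `x`. -/
theorem obstacle_solution_usc
    {X : Type*} [MetricSpace X] [MeasurableSpace X] [BorelSpace X]
    (μ : Measure X) (Cd CP lam : ℝ) (hX : MMS μ Cd CP lam)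
    (Ω : Set X) (hΩopen : IsOpen Ω) (hΩne : Ω.Nonempty) (hΩbdd : Bornology.IsBounded Ω)
    (ψ : X → EReal) (f : X → ℝ)
    (hf : MeasureTheory.LocallyIntegrable f μ) (hDf : tv μ f Set.univ < ⊤)
    (u : X → ℝ) (hu : IsObstacleSolution μ ψ f Ω u)
    (x : X) (hx : x ∈ Ω)
    (hψ : upperApproxE μ ψ x =
      ⨅ (r : ℝ) (_ : 0 < r), essSup ψ (μ.restrict (Metric.ball x r))) :
    UpperSemicontinuousWithinAt (upperApprox μ u) Ω x ∧
      (upperApproxE μ ψ x < (⊤ : EReal) →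
        ∃ ε : ℝ, 0 < ε ∧
          (∀ y ∈ Metric.ball x ε ∩ Ω,
            upperApprox μ u y ≠ (⊤ : EReal) ∧ upperApprox μ u y ≠ (⊥ : EReal)) ∧
          UpperSemicontinuousWithinAt (upperApprox μ u) Ω x) := by
  have hproper := hX.properSpace
  have hlocfin := hX.isLocallyFiniteMeasure
  have hint := hu.1.1.locallyIntegrable
  have hT := hu.tv_ne_top hΩne hΩbdd hf hDf
  have htrunc : ∀ k : ℝ, upperApproxE μ ψ x < k →
      ∃ R > 0, closedBall x R ⊆ Ω ∧ ∀ k' ≥ k, TruncMin μ u k' x R := by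
    intro k hk
    rw [hψ] at hk
    obtain ⟨r, hr, hψr⟩ := exists_ball_ae_le_of_iInf_essSup_lt hk
    obtain ⟨ρ, hρ, hρΩ⟩ := Metric.isOpen_iff.1 hΩopen x hx
    have hlt : min r ρ / 2 < min r ρ := half_lt_self (lt_min hr hρ)
    have hsub : closedBall x (min r ρ / 2) ⊆ Ω :=
      (closedBall_subset_ball (hlt.trans_le (min_le_right _ _))).trans hρΩ
    refine ⟨min r ρ / 2, half_pos (lt_min hr hρ), hsub, fun k' hk' => hu.truncMin hsub ?_⟩
    refine (ae_restrict_of_ae_restrict_of_subset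
      (closedBall_subset_ball (hlt.trans_le (min_le_left _ _))) hψr).mono fun z hz => ?_
    exact hz.trans (EReal.coe_le_coe_iff.2 hk')
  have husc : UpperSemicontinuousWithinAt (upperApprox μ u) Ω x := by
    intro c hc
    obtain ⟨k, hk, hkc⟩ := EReal.lt_iff_exists_real_btwn.1 hc
    obtain ⟨k₂, hk₂, hk₂c⟩ := EReal.lt_iff_exists_real_btwn.1 hkc
    rw [EReal.coe_lt_coe_iff] at hk₂
    obtain ⟨R, hR, -, hmin⟩ := htrunc k
      ((upperApproxE_le_upperApprox hΩopen hx hu.1.2.1).trans_lt hk)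
    obtain ⟨r, hr, hbound⟩ := hX.exists_ball_ae_le hint hT hR (sub_pos.2 hk₂) hmin hk
    rw [add_sub_cancel] at hbound
    filter_upwards [mem_nhdsWithin_of_mem_nhds (ball_mem_nhds x hr)] with y hy
    exact (upperApprox_le_of_ae_le hbound hy).trans_lt hk₂c
  refine ⟨husc, fun hlt => ?_⟩
  obtain ⟨k, hk, -⟩ := EReal.lt_iff_exists_real_btwn.1 hlt
  obtain ⟨R, hR, hRΩ, hmin⟩ := htrunc k hk
  obtain ⟨M, hM⟩ := hX.exists_ae_le_of_truncMin hint hT hR hmin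
  obtain ⟨M', hM'⟩ := hX.exists_ae_le_of_truncMin (k := 0) hint.neg ((tv_neg u univ).trans_ne hT) hR
    fun k' _ => hu.truncMin_neg hRΩ k'
  refine ⟨R / 2, half_pos hR, fun y hy => ⟨?_, ?_⟩, husc⟩
  · exact ((upperApprox_le_of_ae_le hM hy.1).trans_lt (EReal.coe_lt_top M)).ne
  · refine ((EReal.bot_lt_coe (-M')).trans_le (hX.le_upperApprox_of_ae_le ?_ hy.1)).ne'
    filter_upwards [hM'] with z hz
    exact neg_le.1 hz

end MetricBV
end
end

section
/- Let A ⊂ X, x ∈ X, R > 0, and M > 1 be such that lim_{i→∞} M^{−i}R · cap₁(A ∩ B(x,M^{−i}R), B(x,2M^{−i}R)) / μ(B(x,M^{−i}R)) = 0. Then lim_{r→0} r · cap₁(A ∩ B(x,r), B(x,2r)) / μ(B(x,r)) = 0; that is, 1-thinness along the discrete sequence of radii M^{−i}R implies 1-thinness at x. -/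
open MeasureTheory Metric Filter Set
open scoped ENNReal NNReal Topology

noncomputable section

namespace MetricBV

variable {X : Type*} [MetricSpace X] [MeasurableSpace X]

theorem exists_isUpperGradientOn_of_isWeakUpperGradientOn {μ : Measure X} {g : X → ℝ≥0∞}
    {u : X → ℝ} {Ω : Set X} (hg : Measurable g) (hgu : IsWeakUpperGradientOn μ g u Ω)
    {ε : ℝ≥0∞} (hε : ε ≠ 0) :
    ∃ g' : X → ℝ≥0∞, Measurable g' ∧ IsUpperGradientOn g' u Ω ∧
      ∫⁻ x, g' x ∂μ ≤ ∫⁻ x, g x ∂μ + ε := by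
  obtain ⟨Γ, hΓ, hgΓ⟩ := hgu
  obtain ⟨δ, hδ, hδε⟩ := ENNReal.exists_pos_sum_of_countable' hε ℕ
  have hex : ∀ n, ∃ ρ : X → ℝ≥0∞, Measurable ρ ∧ (∀ γ ∈ Γ, 1 ≤ curveIntegral ρ γ) ∧
      ∫⁻ x, ρ x ∂μ < δ n := by
    intro n
    have h := hδ n
    rw [← hΓ, Mod1] at h
    simpa only [iInf_lt_iff, exists_prop] using h
  choose ρ hρm hρΓ hρδ using hex
  refine ⟨fun x => g x + ∑' n, ρ n x, hg.add (Measurable.tsum hρm), ?_, ?_⟩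
  · intro γ hγ
    by_cases hmem : γ ∈ Γ
    · have hsum : ∀ N : ℕ, (N : ℝ≥0∞) ≤ curveIntegral (fun x => ∑ n ∈ Finset.range N, ρ n x) γ := by
        intro N
        induction N with
        | zero => simp
        | succ N ih =>
          calc ((N + 1 : ℕ) : ℝ≥0∞) = N + 1 := by push_cast; rfl
            _ ≤ curveIntegral (fun x => ∑ n ∈ Finset.range N, ρ n x) γ
                + curveIntegral (ρ N) γ := add_le_add ih (hρΓ N γ hmem)
            _ ≤ _ := by
              simp only [curveIntegral, Finset.sum_range_succ, add_mul]
              exact le_lintegral_add _ _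
      have htop : curveIntegral (fun x => g x + ∑' n, ρ n x) γ = ⊤ := by
        refine ENNReal.eq_top_of_forall_nnreal_le fun r => ?_
        obtain ⟨N, hN⟩ := exists_nat_ge r
        calc (r : ℝ≥0∞) ≤ N := by exact_mod_cast hN
          _ ≤ _ := hsum N
          _ ≤ _ := by
            refine lintegral_mono fun t => mul_le_mul_left ?_ _
            exact (ENNReal.sum_le_tsum _).trans le_add_self
      rw [htop]
      exact le_top
    · exact (hgΓ γ hmem hγ).trans (lintegral_mono fun t => mul_le_mul_left le_self_add _)
  · rw [lintegral_add_left hg, lintegral_tsum fun n => (hρm n).aemeasurable]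
    gcongr
    exact (ENNReal.tsum_le_tsum fun n => (hρδ n).le).trans hδε.le

theorem IsUpperGradientOn.isWeakUpperGradientOn {μ : Measure X} {g : X → ℝ≥0∞}
    {u : X → ℝ} {Ω : Set X} (h : IsUpperGradientOn g u Ω) : IsWeakUpperGradientOn μ g u Ω := by
  refine ⟨∅, ?_, fun γ _ hγ => h γ hγ⟩
  refine le_antisymm ?_ bot_le
  exact iInf_le_of_le (fun _ => 0) (iInf_le_of_le measurable_const
    (iInf_le_of_le (by simp) (by simp)))

theorem map_mul_left_nhdsNE_zero {c : ℝ} (hc : c ≠ 0) :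
    Filter.map (fun h => c * h) (𝓝[≠] (0 : ℝ)) = 𝓝[≠] (0 : ℝ) := by
  have h := (Homeomorph.mulLeft₀ c hc).isInducing.map_nhdsWithin_eq ({0}ᶜ) 0
  rw [Set.image_compl_eq (Homeomorph.mulLeft₀ c hc).bijective, Set.image_singleton] at h
  simpa using h

theorem speed_comp_affine {Y : Type*} [MetricSpace Y] (γ : ℝ → Y) (a : ℝ) {c : ℝ} (hc : 0 < c) (t : ℝ) :
    speed (fun s => γ (a + c * s)) t = ENNReal.ofReal c * speed γ (a + c * t) := by
  have key : ∀ h : ℝ, ENNReal.ofReal (dist (γ (a + c * (t + h))) (γ (a + c * t)) / |h|) =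
      ENNReal.ofReal c *
        ENNReal.ofReal (dist (γ (a + c * t + c * h)) (γ (a + c * t)) / |c * h|) := by
    intro h
    rw [← ENNReal.ofReal_mul hc.le, abs_mul, abs_of_pos hc, mul_add, ← add_assoc]
    congr 1
    rcases eq_or_ne h 0 with rfl | hh
    · simp
    · have : |h| ≠ 0 := abs_ne_zero.2 hh
      field_simp
  simp only [speed, key]
  rw [ENNReal.limsup_const_mul_of_ne_top ENNReal.ofReal_ne_top]
  congr 1
  conv_rhs => rw [← map_mul_left_nhdsNE_zero hc.ne']
  rfl

/-- The affine reparametrization of the restriction of a curve to `[a, b] ⊆ [0, 1]`. -/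
def Curve.restrict (γ : Curve X) {a b : ℝ} (ha : 0 ≤ a) (hab : a ≤ b) (hb : b ≤ 1) : Curve X where
  toFun s := γ.toFun (a + (b - a) * s)
  lipschitz := by
    obtain ⟨K, hK⟩ := γ.lipschitz
    refine ⟨K * (b - a).toNNReal, LipschitzOnWith.of_dist_le_mul fun s hs t ht => ?_⟩
    have hmem : ∀ s ∈ Set.Icc (0 : ℝ) 1, a + (b - a) * s ∈ Set.Icc (0 : ℝ) 1 := fun s hs =>
      ⟨by nlinarith [hs.1], by nlinarith [hs.2]⟩
    refine (hK.dist_le_mul _ (hmem s hs) _ (hmem t ht)).trans_eq ?_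
    rw [Real.dist_eq, Real.dist_eq, NNReal.coe_mul, Real.coe_toNNReal _ (sub_nonneg.2 hab),
      add_sub_add_left_eq_sub, ← mul_sub, abs_mul, abs_of_nonneg (sub_nonneg.2 hab), mul_assoc]

theorem curveIntegral_restrict {Y : Type*} [MetricSpace Y] (g : Y → ℝ≥0∞) (γ : Curve Y)
    {a b : ℝ} (ha : 0 ≤ a) (hab : a < b) (hb : b ≤ 1) :
    curveIntegral g (γ.restrict ha hab.le hb) =
      ∫⁻ t in Set.Icc a b, g (γ.toFun t) * speed γ.toFun t := by
  have hc : 0 < b - a := sub_pos.2 hab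
  have himg : (fun s => a + (b - a) * s) '' Set.Icc (0 : ℝ) 1 = Set.Icc a b := by
    have := Set.image_affine_Icc' hc a 0 1
    simpa [add_comm] using this
  rw [← himg, lintegral_image_eq_lintegral_abs_deriv_mul (f' := fun _ => b - a) measurableSet_Icc
    (fun s _ => by simpa using (((hasDerivAt_id s).const_mul (b - a)).const_add a).hasDerivWithinAt)
    (fun s _ t _ hst => by simpa [hc.ne'] using hst)]
  refine lintegral_congr fun s => ?_
  rw [abs_of_pos hc]
  simp only [Curve.restrict, speed_comp_affine γ.toFun a hc]
  ring

theorem IsUpperGradientOn.le_setLIntegral {Y : Type*} [MetricSpace Y] {g : Y → ℝ≥0∞} {u : Y → ℝ}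
    (h : IsUpperGradientOn g u Set.univ) (γ : Curve Y) {a b : ℝ} (ha : 0 ≤ a)
    (hab : a ≤ b) (hb : b ≤ 1) :
    ENNReal.ofReal |u (γ.toFun b) - u (γ.toFun a)| ≤
      ∫⁻ t in Set.Icc a b, g (γ.toFun t) * speed γ.toFun t := by
  rcases hab.eq_or_lt with rfl | hab
  · simp
  rw [← curveIntegral_restrict g γ ha hab hb]
  simpa [Curve.restrict] using h (γ.restrict ha hab.le hb) (fun _ _ => Set.mem_univ _)

theorem ofReal_abs_deriv_comp_le_speed {Y : Type*} [MetricSpace Y] {η : Y → ℝ} {L : ℝ≥0}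
    (hη : LipschitzWith L η) (γ : ℝ → Y) (t : ℝ) :
    ENNReal.ofReal |deriv (fun s => η (γ s)) t| ≤ L * speed γ t := by
  by_cases hd : DifferentiableAt ℝ (fun s => η (γ s)) t
  · have h := hasDerivAt_iff_tendsto_slope_zero.1 hd.hasDerivAt
    have h' := (ENNReal.continuous_ofReal.comp continuous_abs).continuousAt.tendsto.comp h
    have heq := h'.limsup_eq
    simp only [Function.comp_apply] at heq
    rw [← heq, speed, ← ENNReal.limsup_const_mul_of_ne_top ENNReal.coe_ne_top]
    refine limsup_le_limsup (Eventually.of_forall fun s => ?_)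
    simp only [Function.comp_apply, smul_eq_mul]
    rw [← ENNReal.ofReal_coe_nnreal, ← ENNReal.ofReal_mul L.coe_nonneg]
    refine ENNReal.ofReal_le_ofReal ?_
    rw [abs_mul, abs_inv, inv_mul_eq_div, ← mul_div_assoc]
    gcongr
    exact hη.dist_le_mul _ _
  · simp [deriv_zero_of_not_differentiableAt hd]

theorem absolutelyContinuousOnInterval_of_dist_le {f F : ℝ → ℝ} {a b : ℝ}
    (hF : AbsolutelyContinuousOnInterval F a b)
    (h : ∀ s ∈ Set.uIcc a b, ∀ t ∈ Set.uIcc a b, dist (f s) (f t) ≤ dist (F s) (F t)) :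
    AbsolutelyContinuousOnInterval f a b := by
  rw [absolutelyContinuousOnInterval_iff] at hF ⊢
  intro ε hε
  obtain ⟨δ, hδ, H⟩ := hF ε hε
  refine ⟨δ, hδ, fun E hE hEδ => (Finset.sum_le_sum fun i hi => ?_).trans_lt (H E hE hEδ)⟩
  exact h _ (hE.1 i hi).1 _ (hE.1 i hi).2

theorem abs_deriv_le_abs_of_eventually_dist_le {f F : ℝ → ℝ} {t F' : ℝ}
    (hF : HasDerivAt F F' t) (h : ∀ᶠ s in 𝓝 t, dist (f s) (f t) ≤ dist (F s) (F t)) :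
    |deriv f t| ≤ |F'| := by
  by_cases hd : DifferentiableAt ℝ f t
  · refine le_of_tendsto_of_tendsto (hasDerivAt_iff_tendsto_slope.1 hd.hasDerivAt).abs
      (hasDerivAt_iff_tendsto_slope.1 hF).abs ?_
    filter_upwards [h.filter_mono nhdsWithin_le_nhds] with s hs
    simp only [slope, vsub_eq_sub, smul_eq_mul, abs_mul]
    exact mul_le_mul_of_nonneg_left hs (abs_nonneg _)
  · simp [deriv_zero_of_not_differentiableAt hd]

/-- An integrable density controlling the increments of a function makes it absolutely continuous,
and dominates its derivative almost everywhere. -/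
theorem absolutelyContinuousOnInterval_of_le_setLIntegral {f : ℝ → ℝ} {h : ℝ → ℝ≥0∞}
    (hfin : ∫⁻ t in Set.Icc (0 : ℝ) 1, h t ≠ ⊤)
    (hf : ∀ a b : ℝ, 0 ≤ a → a ≤ b → b ≤ 1 →
      ENNReal.ofReal |f b - f a| ≤ ∫⁻ t in Set.Icc a b, h t) :
    AbsolutelyContinuousOnInterval f 0 1 ∧
      ∀ᵐ t ∂volume.restrict (Set.Ioc (0 : ℝ) 1), ENNReal.ofReal |deriv f t| ≤ h t := by
  obtain ⟨φ, hφm, hφh, hφ⟩ := exists_measurable_le_setLIntegral_eq_of_integrable hfin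
  have hφfin : ∫⁻ t in Set.Icc (0 : ℝ) 1, φ t ≠ ⊤ :=
    ((lintegral_mono hφh).trans_lt hfin.lt_top).ne
  have hint : IntegrableOn (fun t => (φ t).toReal) (Set.Icc 0 1) :=
    integrable_toReal_of_lintegral_ne_top hφm.aemeasurable hφfin
  have hii : IntervalIntegrable (fun t => (φ t).toReal) volume 0 1 :=
    (intervalIntegrable_iff_integrableOn_Icc_of_le zero_le_one).2 hint
  set F : ℝ → ℝ := fun t => ∫ s in (0 : ℝ)..t, (φ s).toReal with hF
  have hac : AbsolutelyContinuousOnInterval F 0 1 :=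
    hii.absolutelyContinuousOnInterval_intervalIntegral (by simp)
  have hle : ∀ a b : ℝ, 0 ≤ a → a ≤ b → b ≤ 1 → |f b - f a| ≤ F b - F a := by
    intro a b ha hab hb
    have hsub : Set.Icc a b ⊆ Set.Icc 0 1 := Set.Icc_subset_Icc ha hb
    have hii' : ∀ c d : ℝ, 0 ≤ c → c ≤ d → d ≤ 1 →
        IntervalIntegrable (fun t => (φ t).toReal) volume c d := fun c d hc hcd hd =>
      (intervalIntegrable_iff_integrableOn_Icc_of_le hcd).2
        (hint.mono_set (Set.Icc_subset_Icc hc hd))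
    have hFab : F b - F a = ∫ s in Set.Icc a b, (φ s).toReal := by
      rw [hF, intervalIntegral.integral_interval_sub_left (hii' 0 b le_rfl (ha.trans hab) hb)
        (hii' 0 a le_rfl ha (hab.trans hb)), intervalIntegral.integral_of_le hab,
        integral_Icc_eq_integral_Ioc]
    have hfin' : ∫⁻ t in Set.Icc a b, φ t ≠ ⊤ :=
      ((lintegral_mono_set hsub).trans_lt hφfin.lt_top).ne
    rw [hFab, integral_toReal hφm.aemeasurable (ae_lt_top hφm hfin')]
    refine (ENNReal.ofReal_le_iff_le_toReal hfin').1 ((hf a b ha hab hb).trans_eq ?_)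
    have := hφ (Set.Icc a b) measurableSet_Icc
    rwa [Measure.restrict_restrict measurableSet_Icc, Set.inter_eq_left.2 hsub] at this
  have hdist : ∀ s ∈ Set.Icc (0 : ℝ) 1, ∀ t ∈ Set.Icc (0 : ℝ) 1,
      dist (f s) (f t) ≤ dist (F s) (F t) := by
    intro s hs t ht
    rcases le_total s t with hst | hst
    · rw [dist_comm, dist_comm (F s)]
      exact (hle s t hs.1 hst ht.2).trans (le_abs_self _)
    · exact (hle t s ht.1 hst hs.2).trans (le_abs_self _)
  refine ⟨absolutelyContinuousOnInterval_of_dist_le hac (by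
    rwa [Set.uIcc_of_le zero_le_one]), ?_⟩
  rw [ae_restrict_iff' measurableSet_Ioc]
  filter_upwards [hii.ae_hasDerivAt_integral, compl_mem_ae_iff.2 (measure_singleton (1 : ℝ))]
    with t ht ht1 htm
  have htm' : t ∈ Set.uIcc (0 : ℝ) 1 := by
    rw [Set.uIcc_of_le zero_le_one]; exact Set.Ioc_subset_Icc_self htm
  have hnhds : Set.Icc (0 : ℝ) 1 ∈ 𝓝 t :=
    Icc_mem_nhds htm.1 (lt_of_le_of_ne htm.2 ht1)
  have h1 := abs_deriv_le_abs_of_eventually_dist_le (f := f) (ht htm' 0 (by simp))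
    (by filter_upwards [hnhds] with s hs using hdist s hs t (mem_of_mem_nhds hnhds))
  calc ENNReal.ofReal |deriv f t| ≤ ENNReal.ofReal |(φ t).toReal| := ENNReal.ofReal_le_ofReal h1
    _ ≤ φ t := by rw [abs_of_nonneg ENNReal.toReal_nonneg]; exact ENNReal.ofReal_toReal_le
    _ ≤ h t := hφh t

/-- Leibniz rule for upper gradients, with a bounded Lipschitz factor. -/
theorem IsUpperGradientOn.mul_lipschitz {Y : Type*} [MetricSpace Y] {g w : Y → ℝ≥0∞}
    {u η : Y → ℝ} {L : ℝ≥0}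
    (hg : IsUpperGradientOn g u Set.univ) (hη : LipschitzWith L η) (hη1 : ∀ x, |η x| ≤ 1)
    (hw : ∀ x, ENNReal.ofReal |u x| ≤ w x) :
    IsUpperGradientOn (fun x => g x + L * w x) (fun x => u x * η x) Set.univ := by
  intro γ _
  by_cases hfin : curveIntegral g γ = ⊤
  · refine le_top.trans (hfin.symm.le.trans ?_)
    exact lintegral_mono fun t => mul_le_mul_left le_self_add _
  obtain ⟨hac, hderiv⟩ := absolutelyContinuousOnInterval_of_le_setLIntegral
    (f := fun t => u (γ.toFun t)) hfin fun a b ha hab hb => hg.le_setLIntegral γ ha hab hb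
  obtain ⟨K, hK⟩ := γ.lipschitz
  have hacη : AbsolutelyContinuousOnInterval (fun t => η (γ.toFun t)) 0 1 := by
    refine LipschitzOnWith.absolutelyContinuousOnInterval (K := L * K) ?_
    rw [Set.uIcc_of_le zero_le_one]
    exact hη.comp_lipschitzOnWith hK
  rw [← hac.integral_deriv_mul_eq_sub hacη, intervalIntegral.integral_of_le zero_le_one,
    ← Real.enorm_eq_ofReal_abs]
  refine (enorm_integral_le_lintegral_enorm _).trans ?_
  refine le_trans (lintegral_mono_ae ?_) (lintegral_mono_set Set.Ioc_subset_Icc_self)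
  filter_upwards [hderiv] with t ht
  have h2 := ofReal_abs_deriv_comp_le_speed hη γ.toFun t
  rw [Real.enorm_eq_ofReal_abs]
  calc _ ≤ ENNReal.ofReal (|deriv (fun t => u (γ.toFun t)) t| +
        |u (γ.toFun t)| * |deriv (fun t => η (γ.toFun t)) t|) := by
        refine ENNReal.ofReal_le_ofReal ((abs_add_le _ _).trans ?_)
        rw [abs_mul, abs_mul]
        gcongr
        exact mul_le_of_le_one_right (abs_nonneg _) (hη1 _)
    _ = ENNReal.ofReal |deriv (fun t => u (γ.toFun t)) t| + ENNReal.ofReal |u (γ.toFun t)| *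
        ENNReal.ofReal |deriv (fun t => η (γ.toFun t)) t| := by
        rw [ENNReal.ofReal_add (abs_nonneg _) (by positivity), ENNReal.ofReal_mul (abs_nonneg _)]
    _ ≤ g (γ.toFun t) * speed γ.toFun t + w (γ.toFun t) * (L * speed γ.toFun t) := by
        gcongr
        exact hw _
    _ = _ := by ring

theorem exists_measurable_ge_lintegral_eq_of_aemeasurable {α : Type*} [MeasurableSpace α]
    {μ : Measure α} {f : α → ℝ≥0∞} (hf : AEMeasurable f μ) :
    ∃ w : α → ℝ≥0∞, Measurable w ∧ (∀ x, f x ≤ w x) ∧ ∫⁻ x, w x ∂μ = ∫⁻ x, f x ∂μ := by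
  set N := toMeasurable μ {x | f x ≠ hf.mk f x} with hN
  have hNm : MeasurableSet N := measurableSet_toMeasurable _ _
  have hN0 : μ N = 0 := by rw [hN, measure_toMeasurable]; exact hf.ae_eq_mk
  refine ⟨fun x => hf.mk f x + N.indicator (fun _ => ⊤) x,
    hf.measurable_mk.add (measurable_const.indicator hNm), fun x => ?_, ?_⟩
  · by_cases hx : x ∈ N
    · simp [hx]
    · have : f x = hf.mk f x := by
        by_contra h
        exact hx (subset_toMeasurable _ _ h)
      exact this.le.trans le_self_add
  · rw [lintegral_add_left hf.measurable_mk, lintegral_indicator hNm, setLIntegral_const, hN0,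
      mul_zero, add_zero]
    exact (lintegral_congr_ae hf.ae_eq_mk).symm

namespace MMS

variable {μ : Measure X} {Cd CP lam : ℝ}

theorem measure_ball_pos_s10 (hX : MMS μ Cd CP lam) (x : X) {r : ℝ} (hr : 0 < r) :
    0 < μ (ball x r) := by
  have := (hX.doubling x (r / 2) (half_pos hr)).1
  rwa [mul_div_cancel₀ r two_ne_zero] at this

theorem measure_ball_lt_top_s10 (hX : MMS μ Cd CP lam) (x : X) {r : ℝ} (hr : 0 < r) :
    μ (ball x r) < ⊤ :=
  (hX.doubling x r hr).2.2

theorem isLocallyFiniteMeasure_s10 (hX : MMS μ Cd CP lam) : IsLocallyFiniteMeasure μ :=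
  ⟨fun x => ⟨ball x 1, ball_mem_nhds x one_pos, hX.measure_ball_lt_top_s10 x one_pos⟩⟩

theorem isOpenPosMeasure (hX : MMS μ Cd CP lam) : μ.IsOpenPosMeasure := by
  refine ⟨fun U hU ⟨x, hx⟩ => ?_⟩
  obtain ⟨r, hr, hrU⟩ := Metric.isOpen_iff.1 hU x hx
  exact ((hX.measure_ball_pos_s10 x hr).trans_le (measure_mono hrU)).ne'

theorem measure_ball_two_pow_mul_le (hX : MMS μ Cd CP lam) (x : X) {r : ℝ} (hr : 0 < r) (k : ℕ) :
    μ (ball x (2 ^ k * r)) ≤ ENNReal.ofReal Cd ^ k * μ (ball x r) := by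
  induction k with
  | zero => simp
  | succ k ih =>
    calc μ (ball x (2 ^ (k + 1) * r)) = μ (ball x (2 * (2 ^ k * r))) := by ring_nf
      _ ≤ ENNReal.ofReal Cd * μ (ball x (2 ^ k * r)) := (hX.doubling x _ (by positivity)).2.1
      _ ≤ ENNReal.ofReal Cd * (ENNReal.ofReal Cd ^ k * μ (ball x r)) := by gcongr
      _ = _ := by ring

theorem lintegral_sub_average_le (hX : MMS μ Cd CP lam) (x : X) {r : ℝ} (hr : 0 < r) {u : X → ℝ}
    (hu : LocallyIntegrable u μ) {g : X → ℝ≥0∞} (hg : Measurable g)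
    (hgu : IsUpperGradientOn g u Set.univ) :
    ∫⁻ y in ball x r, ENNReal.ofReal |u y - ⨍ z in ball x r, u z ∂μ| ∂μ ≤
      ENNReal.ofReal (CP * r) * ∫⁻ y, g y ∂μ := by
  refine (hX.poincare x r hr u hu g hg hgu).trans ?_
  have h1 : μ (ball x r) / μ (ball x (lam * r)) ≤ 1 :=
    ENNReal.div_le_of_le_mul (by
      rw [one_mul]
      exact measure_mono (ball_subset_ball (le_mul_of_one_le_left hr.le hX.hlam)))
  calc _ ≤ ENNReal.ofReal (CP * r) * 1 * ∫⁻ y, g y ∂μ := by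
        exact mul_le_mul' (mul_le_mul_right h1 _) (setLIntegral_le_lintegral _ _)
    _ = _ := by rw [mul_one]

variable [BorelSpace X]

theorem preconnectedSpace (hX : MMS μ Cd CP lam) : PreconnectedSpace X := by
  have := hX.isLocallyFiniteMeasure_s10
  have := hX.isOpenPosMeasure
  rw [preconnectedSpace_iff_clopen]
  intro s hs
  by_contra! hne
  obtain ⟨⟨a, ha⟩, hs'⟩ := hne
  obtain ⟨b, hb⟩ := (Set.ne_univ_iff_exists_notMem s).1 hs'
  set u : X → ℝ := s.indicator fun _ => 1 with hu
  have hui : LocallyIntegrable u μ := (locallyIntegrable_const 1).indicator hs.isOpen.measurableSet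
  have hug : IsUpperGradientOn (fun _ => 0) u Set.univ := by
    intro γ _
    obtain ⟨K, hK⟩ := γ.lipschitz
    have hpre : IsPreconnected (γ.toFun '' Set.Icc 0 1) :=
      isPreconnected_Icc.image _ hK.continuousOn
    have h0 : γ.toFun 0 ∈ γ.toFun '' Set.Icc 0 1 := ⟨0, by simp, rfl⟩
    have h1 : γ.toFun 1 ∈ γ.toFun '' Set.Icc 0 1 := ⟨1, by simp, rfl⟩
    have heq : u (γ.toFun 1) = u (γ.toFun 0) := by
      by_cases h : γ.toFun 0 ∈ s
      · have := hpre.subset_isClopen hs ⟨_, h0, h⟩ h1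
        simp [hu, h, this]
      · have : γ.toFun 1 ∉ s := fun h' => h (hpre.subset_isClopen hs ⟨_, h1, h'⟩ h0)
        simp [hu, h, this]
    simp [heq]
  have hr : 0 < dist b a + 1 := by positivity
  set c := ⨍ z in ball a (dist b a + 1), u z ∂μ with hc
  have hz := hX.lintegral_sub_average_le a hr hui measurable_const hug
  rw [lintegral_zero, mul_zero, nonpos_iff_eq_zero, ← hc, lintegral_eq_zero_iff' (by
    have : Measurable u := measurable_const.indicator hs.isOpen.measurableSet
    fun_prop), Filter.EventuallyEq, ae_restrict_iff' measurableSet_ball] at hz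
  have hd := Measure.dense_of_ae hz
  obtain ⟨y, hy, hy'⟩ := hd.inter_open_nonempty _ (hs.isOpen.inter isOpen_ball)
    ⟨a, ha, mem_ball_self hr⟩
  obtain ⟨y₂, hy₂, hy₂'⟩ := hd.inter_open_nonempty _ (hs.compl.isOpen.inter isOpen_ball)
    ⟨b, hb, mem_ball.2 (lt_add_one _)⟩
  have e1 := hy' hy.2
  have e2 := hy₂' hy₂.2
  have m1 : u y = 1 := Set.indicator_of_mem hy.1 _
  have m2 : u y₂ = 0 := Set.indicator_of_notMem hy₂.1 _
  rw [m1] at e1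
  rw [m2] at e2
  simp only [Pi.zero_apply, ENNReal.ofReal_eq_zero, abs_nonpos_iff] at e1 e2
  linarith

/-- Sobolev inequality for functions vanishing outside of a small ball. -/
theorem lintegral_abs_le (hX : MMS μ Cd CP lam) {x : X} {s : ℝ} (hs : 0 < s)
    (hfar : ∃ z, 3 * s ≤ dist z x) {u : X → ℝ} (hu : Integrable u μ)
    (hu0 : ∀ y ∈ (ball x (2 * s))ᶜ, u y = 0) {g : X → ℝ≥0∞} (hg : Measurable g)
    (hgu : IsUpperGradientOn g u Set.univ) :
    ∫⁻ y, ENNReal.ofReal |u y| ∂μ ≤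
      ENNReal.ofReal ((1 + Cd ^ 3) * (CP * (4 * s))) * ∫⁻ y, g y ∂μ := by
  have := hX.preconnectedSpace
  have hCd := hX.hCd
  obtain ⟨z, hz⟩ := hfar
  obtain ⟨y, hy⟩ : 3 * s ∈ Set.range fun y => dist y x :=
    mem_range_of_exists_le_of_exists_ge (by fun_prop) ⟨x, by simp; positivity⟩ ⟨z, hz⟩
  simp only at hy
  have hP := hX.lintegral_sub_average_le x (r := 4 * s) (by positivity) hu.locallyIntegrable hg hgu
  set c := ⨍ z in ball x (4 * s), u z ∂μ with hc
  set I := ∫⁻ y in ball x (4 * s), ENNReal.ofReal |u y - c| ∂μ with hI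
  have hsub1 : ball y s ⊆ ball x (4 * s) := ball_subset_ball' (by linarith)
  have hsub2 : ball y s ⊆ (ball x (2 * s))ᶜ := by
    intro w hw hw'
    rw [mem_ball] at hw hw'
    have := dist_triangle_left y x w
    linarith
  have hmeas : μ (ball x (4 * s)) ≤ ENNReal.ofReal Cd ^ 3 * μ (ball y s) :=
    (measure_mono (ball_subset_ball' (by rw [dist_comm]; linarith))).trans
      (hX.measure_ball_two_pow_mul_le y hs 3)
  have hcE : ENNReal.ofReal |c| * μ (ball y s) ≤ I := by
    rw [← setLIntegral_const]
    refine le_trans (setLIntegral_mono' measurableSet_ball fun w hw => ?_)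
      (lintegral_mono_set hsub1)
    rw [hu0 w (hsub2 hw), zero_sub, abs_neg]
  have hB : ∫⁻ y, ENNReal.ofReal |u y| ∂μ = ∫⁻ y in ball x (4 * s), ENNReal.ofReal |u y| ∂μ := by
    refine (setLIntegral_eq_of_support_subset fun w hw => ?_).symm
    by_contra hw'
    refine hw ?_
    have : u w = 0 := hu0 w fun h => hw' (ball_subset_ball (by linarith) h)
    simp [this]
  calc ∫⁻ y, ENNReal.ofReal |u y| ∂μ
      = ∫⁻ y in ball x (4 * s), ENNReal.ofReal |u y| ∂μ := hB
    _ ≤ ∫⁻ y in ball x (4 * s), (ENNReal.ofReal |u y - c| + ENNReal.ofReal |c|) ∂μ := by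
        refine lintegral_mono fun w => ?_
        rw [← ENNReal.ofReal_add (abs_nonneg _) (abs_nonneg _)]
        refine ENNReal.ofReal_le_ofReal ?_
        simpa using abs_add_le (u w - c) c
    _ = I + ENNReal.ofReal |c| * μ (ball x (4 * s)) := by
        rw [lintegral_add_right _ measurable_const, setLIntegral_const]
    _ ≤ I + ENNReal.ofReal |c| * (ENNReal.ofReal Cd ^ 3 * μ (ball y s)) := by gcongr
    _ = I + ENNReal.ofReal Cd ^ 3 * (ENNReal.ofReal |c| * μ (ball y s)) := by ring
    _ ≤ I + ENNReal.ofReal Cd ^ 3 * I := by gcongr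
    _ = ENNReal.ofReal (1 + Cd ^ 3) * I := by
        rw [ENNReal.ofReal_add zero_le_one (by positivity), ENNReal.ofReal_one,
          ENNReal.ofReal_pow (by positivity)]
        ring
    _ ≤ ENNReal.ofReal (1 + Cd ^ 3) * (ENNReal.ofReal (CP * (4 * s)) * ∫⁻ y, g y ∂μ) := by gcongr
    _ = _ := by rw [← mul_assoc, ← ENNReal.ofReal_mul (by positivity)]

theorem vcap1_inter_ball_le (hX : MMS μ Cd CP lam) (A : Set X) {x : X} {r s : ℝ} (hr : 0 < r)
    (hrs : r ≤ s) (hfar : ∃ z, 3 * s ≤ dist z x) :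
    vcap1 μ (A ∩ ball x r) (ball x (2 * r)) ≤
      ENNReal.ofReal (1 + r⁻¹ * ((1 + Cd ^ 3) * (CP * (4 * s)))) *
        vcap1 μ (A ∩ ball x s) (ball x (2 * s)) := by
  have hs : 0 < s := hr.trans_le hrs
  have hCd := hX.hCd
  have hCP := hX.hCP
  set C := (1 + Cd ^ 3) * (CP * (4 * s)) with hC
  have hC0 : 0 ≤ C := by positivity
  set K := ENNReal.ofReal (1 + r⁻¹ * C) with hK
  have hK0 : K ≠ 0 := (ENNReal.ofReal_pos.2 (by positivity)).ne'
  have hKtop : K ≠ ⊤ := ENNReal.ofReal_ne_top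
  rw [mul_comm K, ← ENNReal.div_le_iff_le_mul (.inl hK0) (.inl hKtop)]
  refine le_iInf fun u => le_iInf fun hu => le_iInf fun hu1 => le_iInf fun hu0 =>
    le_iInf fun g => le_iInf fun hg => le_iInf fun hgu => ?_
  refine ENNReal.le_of_forall_pos_le_add fun ε hε hfin => ?_
  rw [ENNReal.div_le_iff_le_mul (.inl hK0) (.inl hKtop), mul_comm _ K]
  obtain ⟨g', hg', hgu', hgε⟩ := exists_isUpperGradientOn_of_isWeakUpperGradientOn hg hgu
    (ENNReal.coe_pos.2 hε).ne'
  obtain ⟨w, hwm, hw, hwint⟩ := exists_measurable_ge_lintegral_eq_of_aemeasurable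
    (f := fun y => ENNReal.ofReal |u y|) (μ := μ) (by
      have := hu.1.aestronglyMeasurable.aemeasurable
      fun_prop)
  set η : X → ℝ := fun y => max 0 (min 1 (2 - r⁻¹ * dist y x)) with hη
  have hηL : LipschitzWith r⁻¹.toNNReal η := by
    refine LipschitzWith.const_max (LipschitzWith.const_min (LipschitzWith.of_dist_le_mul ?_) _) _
    intro y z
    rw [Real.dist_eq, sub_sub_sub_cancel_left, ← mul_sub, abs_mul, abs_of_pos (inv_pos.2 hr),
      Real.coe_toNNReal _ (inv_pos.2 hr).le, dist_comm y z]
    gcongr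
    exact abs_dist_sub_le z y x
  have hη1 : ∀ y, |η y| ≤ 1 := fun y => by
    rw [abs_of_nonneg (le_max_left _ _)]
    exact max_le zero_le_one (min_le_left _ _)
  have hgv := hgu'.mul_lipschitz hηL hη1 hw
  have hgvm : Measurable fun y => g' y + (r⁻¹.toNNReal : ℝ≥0∞) * w y :=
    hg'.add (hwm.const_mul _)
  have hgvint : ∫⁻ y, (g' y + (r⁻¹.toNNReal : ℝ≥0∞) * w y) ∂μ ≤ K * (∫⁻ y, g y ∂μ + ε) := by
    rw [lintegral_add_left hg', lintegral_const_mul _ hwm, hwint]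
    calc _ ≤ ∫⁻ y, g' y ∂μ + ENNReal.ofReal r⁻¹ * (ENNReal.ofReal C * ∫⁻ y, g' y ∂μ) := by
          gcongr
          · exact le_rfl
          · exact hX.lintegral_abs_le hs hfar hu.1 hu0 hg' hgu'
      _ = K * ∫⁻ y, g' y ∂μ := by
          rw [hK, ENNReal.ofReal_add zero_le_one (by positivity), ENNReal.ofReal_one,
            ENNReal.ofReal_mul (inv_pos.2 hr).le]
          ring
      _ ≤ _ := by gcongr
  refine le_trans ?_ hgvint
  refine iInf_le_of_le (fun y => u y * η y) (iInf_le_of_le ⟨?_, _, hgvm,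
    hgv.isWeakUpperGradientOn, hgvint.trans_lt ?_⟩ (iInf_le_of_le ?_ (iInf_le_of_le ?_
    (iInf_le_of_le _ (iInf_le_of_le hgvm (iInf_le_of_le hgv.isWeakUpperGradientOn le_rfl))))))
  · exact hu.1.mul_bdd (c := 1) hηL.continuous.measurable.aestronglyMeasurable
      (Eventually.of_forall hη1)
  · exact ENNReal.mul_lt_top hKtop.lt_top (ENNReal.add_lt_top.2 ⟨hfin, ENNReal.coe_lt_top⟩)
  · intro y hy
    have hyr : r⁻¹ * dist y x ≤ 1 := by
      rw [inv_mul_le_one₀ hr]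
      exact (mem_ball.1 hy.2).le
    have : η y = 1 := by
      simp only [hη]
      rw [min_eq_left (by linarith), max_eq_right zero_le_one]
    beta_reduce
    rw [this, mul_one]
    exact hu1 y ⟨hy.1, ball_subset_ball hrs hy.2⟩
  · intro y hy
    have hyr : 2 * r ≤ dist y x := by simpa using hy
    have hyr' : 2 ≤ r⁻¹ * dist y x := by
      rw [inv_mul_eq_div, le_div_iff₀ hr]
      exact hyr
    have : η y = 0 := by
      simp only [hη]
      exact max_eq_left ((min_le_right _ _).trans (by linarith))
    beta_reduce
    rw [this, mul_zero]

end MMS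

/-- **Discrete characterization of thinness.** If
`M^{-i}R · cap₁(A ∩ B(x,M^{-i}R), B(x,2M^{-i}R)) / μ(B(x,M^{-i}R)) → 0` as `i → ∞`
for some `R > 0` and `M > 1`, then `A` is 1-thin at `x`. -/
theorem discrete_thinness_condition
    {X : Type*} [MetricSpace X] [MeasurableSpace X] [BorelSpace X]
    (μ : Measure X) (Cd CP lam : ℝ) (hX : MMS μ Cd CP lam)
    (A : Set X) (x : X) (R M : ℝ) (hR : 0 < R) (hM : 1 < M)
    (hdisc : Filter.Tendsto (fun i : ℕ =>
        ENNReal.ofReal (R / M ^ i) *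
          vcap1 μ (A ∩ Metric.ball x (R / M ^ i)) (Metric.ball x (2 * (R / M ^ i)))
            / μ (Metric.ball x (R / M ^ i)))
      Filter.atTop (𝓝 0)) :
    IsThinAt μ A x := by
  have hCd := hX.hCd
  have hCP := hX.hCP
  have hM0 : 0 < M := one_pos.trans hM
  obtain ⟨z, hz⟩ := @exists_ne X hX.nontrivial x
  have hd : 0 < dist z x := dist_pos.2 hz
  obtain ⟨k, hk⟩ := pow_unbounded_of_one_lt M one_lt_two
  set C := (1 + Cd ^ 3) * (CP * 4) with hC
  set D := ENNReal.ofReal (1 + C * M) * ENNReal.ofReal Cd ^ k with hD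
  have hDtop : D ≠ ⊤ := ENNReal.mul_ne_top ENNReal.ofReal_ne_top (by simp)
  have hlim := ENNReal.Tendsto.const_mul hdisc (.inr hDtop)
  rw [mul_zero, ENNReal.tendsto_nhds_zero] at hlim
  have hRM : Tendsto (fun i : ℕ => 3 * (R / M ^ i)) atTop (𝓝 0) := by
    simpa using ((tendsto_pow_atTop_atTop_of_one_lt hM).const_div_atTop R).const_mul 3
  rw [IsThinAt, ENNReal.tendsto_nhds_zero]
  intro ε hε
  obtain ⟨N, hN⟩ := eventually_atTop.1 ((hlim ε hε).and (hRM.eventually_le_const hd))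
  have hmem : Set.Ioo 0 (R / M ^ N) ∈ 𝓝[>] (0 : ℝ) := Ioo_mem_nhdsGT (by positivity)
  filter_upwards [hmem] with r hr
  have hr0 := hr.1
  have hMN : M ^ N < R / r := by
    rw [lt_div_iff₀ hr0, mul_comm, ← lt_div_iff₀ (by positivity)]
    exact hr.2
  obtain ⟨n, hn, hn'⟩ := exists_nat_pow_near ((one_le_pow₀ hM.le).trans hMN.le) hM
  have hNn : N ≤ n := Nat.lt_succ_iff.1 ((pow_lt_pow_iff_right₀ hM).1 (hMN.trans hn'))
  obtain ⟨hQ, hfar⟩ := hN n hNn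
  refine le_trans ?_ hQ
  set s := R / M ^ n with hs
  have hs0 : 0 < s := by positivity
  have hrs : r ≤ s := by
    rw [hs, le_div_iff₀ (by positivity), mul_comm]
    exact (le_div_iff₀ hr0).1 hn
  have hsM : s ≤ M * r := by
    rw [hs, div_le_iff₀ (by positivity)]
    have := (div_lt_iff₀ hr0).1 hn'
    rw [pow_succ] at this
    linarith
  have hmeas : μ (ball x s) ≤ ENNReal.ofReal Cd ^ k * μ (ball x r) :=
    (measure_mono (ball_subset_ball (hsM.trans (by gcongr)))).trans
      (hX.measure_ball_two_pow_mul_le x hr0 k)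
  have hinv : (μ (ball x r))⁻¹ ≤ ENNReal.ofReal Cd ^ k * (μ (ball x s))⁻¹ := by
    rw [← div_eq_mul_inv, ENNReal.le_div_iff_mul_le (.inl (hX.measure_ball_pos_s10 x hs0).ne')
      (.inl (hX.measure_ball_lt_top_s10 x hs0).ne), mul_comm, ← div_eq_mul_inv]
    exact ENNReal.div_le_of_le_mul hmeas
  have hcap : vcap1 μ (A ∩ ball x r) (ball x (2 * r)) ≤
      ENNReal.ofReal (1 + C * M) * vcap1 μ (A ∩ ball x s) (ball x (2 * s)) := by
    refine (hX.vcap1_inter_ball_le A hr0 hrs ⟨z, hfar⟩).trans ?_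
    refine mul_le_mul_left (ENNReal.ofReal_le_ofReal (add_le_add_right ?_ _)) _
    have : r⁻¹ * s ≤ M := by
      rw [inv_mul_eq_div, div_le_iff₀ hr0]
      exact hsM
    calc r⁻¹ * ((1 + Cd ^ 3) * (CP * (4 * s))) = C * (r⁻¹ * s) := by rw [hC]; ring
      _ ≤ C * M := by gcongr
  rw [div_eq_mul_inv, div_eq_mul_inv]
  calc _ ≤ ENNReal.ofReal s *
        (ENNReal.ofReal (1 + C * M) * vcap1 μ (A ∩ ball x s) (ball x (2 * s))) *
        (ENNReal.ofReal Cd ^ k * (μ (ball x s))⁻¹) := by gcongr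
    _ = _ := by rw [hD]; ring

end MetricBV
end
end
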